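/- arXiv:2009.04580 — 2 statements merged into one kernel-verified Lean document; each statement's English description precedes it below -/
import Mathlib

section
/- Let n ≥ 2 be an integer and f(s) = s^p − s^q with p > q > 0 and p > 1. Assume one of the following holds: (i) n > 2, 0 < q ≤ 4/(n−2) and q < p ≤ (n+2)/(n−2); (ii) n > 2, 4/(n−2) < q < (4 + √(2n(n+2)))/(2(n−2)) and q < p ≤ P(q), where P(q) = (2(q+1) + √((n+2)(q+1)(n+2−(n−2)q)))/n; (iii) n = 2 and 0 < q < p. Then for every a and b with 0 < a < b < ∞, problem (R) has at most one positive solution. -/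
open Set Filter MeasureTheory

/-- `F(s) = ∫₀ˢ f(t) dt`. -/
noncomputable def Fint (f : ℝ → ℝ) (s : ℝ) : ℝ := ∫ t in (0:ℝ)..s, f t

/-- Condition (f1): `f` is continuous on `[0,∞)`, continuously differentiable on `(0,∞)`,
and `f' ∈ L¹(0,1)`. -/
def CondF1 (f : ℝ → ℝ) : Prop :=
  ContinuousOn f (Ici 0) ∧ (∀ s ∈ Ioi (0:ℝ), DifferentiableAt ℝ f s) ∧
  ContinuousOn (deriv f) (Ioi 0) ∧ IntervalIntegrable (deriv f) volume 0 1

/-- Condition (f2) in the case `β > B > 0`. -/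
def CondF2B (f : ℝ → ℝ) (β B : ℝ) : Prop :=
  f 0 = 0 ∧ 0 < B ∧ B < β ∧ (∀ s, B < s → 0 < f s) ∧
  (∀ s ∈ Icc (0:ℝ) B, f s ≤ 0) ∧ (∃ ε > (0:ℝ), ∀ s ∈ Ioo (0:ℝ) ε, f s < 0) ∧
  Fint f β = 0

/-- Condition (f2): either `β = B = 0` and `f > 0` on `(0,∞)`, or `β > B > 0` with the
sign conditions and `F(β) = 0`. -/
def CondF2 (f : ℝ → ℝ) (β B : ℝ) : Prop :=
  (β = 0 ∧ B = 0 ∧ f 0 = 0 ∧ ∀ s, 0 < s → 0 < f s) ∨ CondF2B f β B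

/-- Condition (f3): the derivative of `s ↦ F(s)/f(s)` is `≥ (n-2)/(2n)` for every `s > β`. -/
def CondF3 (n : ℕ) (f : ℝ → ℝ) (β : ℝ) : Prop :=
  ∀ s, β < s → ∃ d, ((n : ℝ) - 2) / (2 * (n : ℝ)) ≤ d ∧
    HasDerivAt (fun t => Fint f t / f t) d s

/-- Condition (f4): superlinearity `f(s) ≤ f'(s)(s - B)` for `s > B`, with
`f(s) ≢ f'(s)(s - B)` on `[B, β]`. -/
def CondF4 (f : ℝ → ℝ) (β B : ℝ) : Prop :=
  (∀ s, B < s → f s ≤ deriv f s * (s - B)) ∧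
  ¬ (∀ s ∈ Icc B β, f s = deriv f s * (s - B))

/-- A positive solution of problem (R) on the annulus `a < |x| < b`:
`u` is continuous on `[a,b]`, differentiable up to the boundary with derivative `u'`
(one-sided at the endpoints), `u'` is continuous on `[a,b]`, `u` is twice continuously
differentiable on `(a,b)` where it satisfies `u'' + ((n-1)/r) u' + f(u) = 0`,
`u(a) = u(b) = 0` and `u > 0` on `(a,b)`. -/
def IsPosSolAnn (n : ℕ) (a b : ℝ) (f u u' : ℝ → ℝ) : Prop :=
  ContinuousOn u (Icc a b) ∧
  (∀ r ∈ Icc a b, HasDerivWithinAt u (u' r) (Icc a b) r) ∧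
  ContinuousOn u' (Icc a b) ∧
  (∀ r ∈ Ioo a b, HasDerivAt u (u' r) r) ∧
  (∀ r ∈ Ioo a b, HasDerivAt u' (-(((n : ℝ) - 1) / r * u' r + f (u r))) r) ∧
  u a = 0 ∧ u b = 0 ∧ (∀ r ∈ Ioo a b, 0 < u r)

/-- A positive solution of the exterior problem (R) with `b = ∞`:
`u` is continuous on `[a,∞)`, differentiable on `[a,∞)` with derivative `u'`
(one-sided at `a`), twice continuously differentiable on `(a,∞)` where it satisfies
`u'' + ((n-1)/r) u' + f(u) = 0`, `u(a) = 0`, `u > 0` on `(a,∞)` and `u(r) → 0` as `r → ∞`. -/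
def IsPosSolExt (n : ℕ) (a : ℝ) (f u u' : ℝ → ℝ) : Prop :=
  ContinuousOn u (Ici a) ∧
  (∀ r ∈ Ici a, HasDerivWithinAt u (u' r) (Ici a) r) ∧
  (∀ r ∈ Ioi a, HasDerivAt u (u' r) r) ∧
  (∀ r ∈ Ioi a, HasDerivAt u' (-(((n : ℝ) - 1) / r * u' r + f (u r))) r) ∧
  u a = 0 ∧ (∀ r ∈ Ioi a, 0 < u r) ∧
  Tendsto u atTop (nhds 0)

/-- The Erbe–Tang functional
`P(s) = -2n (F(s)/f(s)) ρ(s)^{n-1} u'(ρ(s)) - ρ(s)^n (u'(ρ(s)))² - 2 ρ(s)^n F(s)`,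
where `ρ` is an inverse branch of the solution `u` with derivative `u'`. -/
noncomputable def Pfun (n : ℕ) (f : ℝ → ℝ) (ρ u' : ℝ → ℝ) (s : ℝ) : ℝ :=
  -2 * (n : ℝ) * (Fint f s / f s) * (ρ s) ^ (n - 1) * u' (ρ s)
    - (ρ s) ^ n * (u' (ρ s)) ^ 2 - 2 * (ρ s) ^ n * Fint f s


namespace AnnU

/-- endpoint form of monotonicity. -/
lemma ends_le {g g' : ℝ → ℝ} {c d : ℝ} (hcd : c ≤ d) (hg : ContinuousOn g (Icc c d))
    (hd : ∀ x ∈ Ioo c d, HasDerivAt g (g' x) x) (h0 : ∀ x ∈ Ioo c d, 0 ≤ g' x) : g c ≤ g d := by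
  have := monotoneOn_of_hasDerivWithinAt_nonneg (convex_Icc c d) hg (f' := g')
    (by rw [interior_Icc]; exact fun x hx => (hd x hx).hasDerivWithinAt)
    (by rw [interior_Icc]; exact h0)
  exact this (left_mem_Icc.2 hcd) (right_mem_Icc.2 hcd) hcd

lemma ends_ge {g g' : ℝ → ℝ} {c d : ℝ} (hcd : c ≤ d) (hg : ContinuousOn g (Icc c d))
    (hd : ∀ x ∈ Ioo c d, HasDerivAt g (g' x) x) (h0 : ∀ x ∈ Ioo c d, g' x ≤ 0) : g d ≤ g c := by
  have := ends_le (g := fun x => - g x) (g' := fun x => - g' x) hcd hg.neg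
    (fun x hx => (hd x hx).neg) (fun x hx => by have := h0 x hx; simp; exact this)
  simpa using this

lemma strictMono_of {g g' : ℝ → ℝ} {c d : ℝ} (hg : ContinuousOn g (Icc c d))
    (hd : ∀ x ∈ Ioo c d, HasDerivAt g (g' x) x) (h0 : ∀ x ∈ Ioo c d, 0 < g' x) :
    StrictMonoOn g (Icc c d) := by
  refine strictMonoOn_of_deriv_pos (convex_Icc c d) hg ?_
  rw [interior_Icc]
  intro x hx
  rw [(hd x hx).deriv]; exact h0 x hx

lemma ends_lt {g g' : ℝ → ℝ} {c d : ℝ} (hcd : c < d) (hg : ContinuousOn g (Icc c d))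
    (hd : ∀ x ∈ Ioo c d, HasDerivAt g (g' x) x) (h0 : ∀ x ∈ Ioo c d, 0 < g' x) : g c < g d :=
  strictMono_of hg hd h0 (left_mem_Icc.2 hcd.le) (right_mem_Icc.2 hcd.le) hcd

lemma ends_gt {g g' : ℝ → ℝ} {c d : ℝ} (hcd : c < d) (hg : ContinuousOn g (Icc c d))
    (hd : ∀ x ∈ Ioo c d, HasDerivAt g (g' x) x) (h0 : ∀ x ∈ Ioo c d, g' x < 0) : g d < g c := by
  have := ends_lt (g := fun x => - g x) (g' := fun x => - g' x) hcd hg.neg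
    (fun x hx => (hd x hx).neg) (fun x hx => by have := h0 x hx; simp; exact this)
  simpa using this

/-- first contact, going up. -/
lemma contact_up {g : ℝ → ℝ} {c d : ℝ} (hg : ContinuousOn g (Icc c d)) (hc : 0 < g c)
    (hn : ¬ ∀ x ∈ Icc c d, 0 < g x) :
    ∃ e ∈ Ioc c d, g e = 0 ∧ ∀ x ∈ Ico c e, 0 < g x := by
  push Not at hn
  obtain ⟨y, hy, hgy⟩ := hn
  have hcy : c ≤ y := hy.1
  have hg' : ContinuousOn g (Icc c y) := hg.mono (Icc_subset_Icc_right hy.2)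
  set K := Icc c y ∩ g ⁻¹' (Iic 0) with hK
  have hKc : IsClosed K := hg'.preimage_isClosed_of_isClosed isClosed_Icc isClosed_Iic
  have hKn : K.Nonempty := ⟨y, ⟨hcy, le_rfl⟩, hgy⟩
  have hKb : BddBelow K := ⟨c, fun x hx => hx.1.1⟩
  have hm := hKc.csInf_mem hKn hKb
  set e := sInf K with he
  have hpos : ∀ x ∈ Ico c e, 0 < g x := by
    intro x hx
    by_contra h
    have : x ∈ K := ⟨⟨hx.1, hx.2.le.trans hm.1.2⟩, not_lt.1 h⟩
    exact absurd (csInf_le hKb this) (not_le.2 hx.2)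
  have hce : c < e := by
    rcases hm.1.1.lt_or_eq with h | h
    · exact h
    · exact absurd hm.2 (by rw [← h]; simpa using hc)
  refine ⟨e, ⟨hce, hm.1.2.trans hy.2⟩, le_antisymm hm.2 ?_, hpos⟩
  have hcont : ContinuousWithinAt g (Ico c e) e :=
    (hg' e hm.1).mono (fun x hx => ⟨hx.1, hx.2.le.trans hm.1.2⟩)
  have : (nhdsWithin e (Ico c e)).NeBot := by
    rw [← mem_closure_iff_nhdsWithin_neBot, closure_Ico hce.ne]
    exact right_mem_Icc.2 hce.le
  refine ge_of_tendsto hcont ?_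
  filter_upwards [self_mem_nhdsWithin] with x hx using (hpos x hx).le

/-- first contact, going down. -/
lemma contact_down {g : ℝ → ℝ} {c d : ℝ} (hg : ContinuousOn g (Icc c d)) (hc : 0 < g d)
    (hn : ¬ ∀ x ∈ Icc c d, 0 < g x) :
    ∃ e ∈ Ico c d, g e = 0 ∧ ∀ x ∈ Ioc e d, 0 < g x := by
  have h1 : ContinuousOn (fun x => g (-x)) (Icc (-d) (-c)) :=
    hg.comp continuous_neg.continuousOn (fun x hx => ⟨by linarith [hx.2], by linarith [hx.1]⟩)
  obtain ⟨e, he, h0, hp⟩ := contact_up h1 (by simpa using hc) (by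
    intro h
    apply hn
    intro x hx
    have := h (-x) ⟨by linarith [hx.2], by linarith [hx.1]⟩
    simpa using this)
  refine ⟨-e, ⟨by linarith [he.2], by linarith [he.1]⟩, h0, fun x hx => ?_⟩
  have := hp (-x) ⟨by linarith [hx.2], by linarith [hx.1]⟩
  simpa using this

lemma inv_branch {g g' : ℝ → ℝ} {c d : ℝ} (hcd : c < d) (hg : ContinuousOn g (Icc c d))
    (hd : ∀ x ∈ Ioo c d, HasDerivAt g (g' x) x) (h0 : ∀ x ∈ Ioo c d, 0 < g' x) :
    ∃ ρ : ℝ → ℝ, (∀ s ∈ Icc (g c) (g d), ρ s ∈ Icc c d ∧ g (ρ s) = s) ∧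
      (∀ x ∈ Icc c d, ρ (g x) = x) ∧ ContinuousOn ρ (Icc (g c) (g d)) ∧
      (∀ s ∈ Ioo (g c) (g d), ρ s ∈ Ioo c d ∧ HasDerivAt ρ (1 / g' (ρ s)) s) := by
  have hm := strictMono_of hg hd h0
  have hsurj : ∀ s ∈ Icc (g c) (g d), ∃ x ∈ Icc c d, g x = s := fun s hs =>
    intermediate_value_Icc hcd.le hg hs
  set ρ := Function.invFunOn g (Icc c d) with hρ
  have h1 : ∀ s ∈ Icc (g c) (g d), ρ s ∈ Icc c d ∧ g (ρ s) = s := fun s hs =>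
    ⟨Function.invFunOn_mem (hsurj s hs), Function.invFunOn_eq (hsurj s hs)⟩
  have hgm : ∀ x ∈ Icc c d, g x ∈ Icc (g c) (g d) := fun x hx =>
    ⟨hm.monotoneOn (left_mem_Icc.2 hcd.le) hx hx.1, hm.monotoneOn hx (right_mem_Icc.2 hcd.le) hx.2⟩
  have h2 : ∀ x ∈ Icc c d, ρ (g x) = x := fun x hx =>
    hm.injOn (h1 _ (hgm x hx)).1 hx (h1 _ (hgm x hx)).2
  have h3 : ContinuousOn ρ (Icc (g c) (g d)) := by
    intro s hs
    refine tendsto_order.2 ⟨fun l hl => ?_, fun l hl => ?_⟩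
    · rcases lt_or_ge l c with h | h
      · filter_upwards [self_mem_nhdsWithin] with x hx using h.trans_le (h1 x hx).1.1
      · have hl' : l ∈ Icc c d := ⟨h, hl.le.trans (h1 s hs).1.2⟩
        have : g l < s := by
          have := hm hl' (h1 s hs).1 hl
          rwa [(h1 s hs).2] at this
        filter_upwards [self_mem_nhdsWithin, mem_nhdsWithin_of_mem_nhds (Ioi_mem_nhds this)]
          with x hx hx2
        by_contra hcon
        have := hm.monotoneOn (h1 x hx).1 hl' (not_lt.1 hcon)
        rw [(h1 x hx).2] at this
        exact absurd hx2 (not_lt.2 this)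
    · rcases lt_or_ge d l with h | h
      · filter_upwards [self_mem_nhdsWithin] with x hx using (h1 x hx).1.2.trans_lt h
      · have hl' : l ∈ Icc c d := ⟨(h1 s hs).1.1.trans hl.le, h⟩
        have : s < g l := by
          have := hm (h1 s hs).1 hl' hl
          rwa [(h1 s hs).2] at this
        filter_upwards [self_mem_nhdsWithin, mem_nhdsWithin_of_mem_nhds (Iio_mem_nhds this)]
          with x hx hx2
        by_contra hcon
        have := hm.monotoneOn hl' (h1 x hx).1 (not_lt.1 hcon)
        rw [(h1 x hx).2] at this
        exact absurd hx2 (not_lt.2 this)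
  refine ⟨ρ, h1, h2, h3, fun s hs => ?_⟩
  have hs' := Ioo_subset_Icc_self hs
  have hmem : ρ s ∈ Ioo c d := by
    refine ⟨lt_of_le_of_ne (h1 s hs').1.1 ?_, lt_of_le_of_ne (h1 s hs').1.2 ?_⟩
    · intro h
      have := (h1 s hs').2
      rw [← h] at this
      exact absurd this hs.1.ne
    · intro h
      have := (h1 s hs').2
      rw [h] at this
      exact absurd this hs.2.ne'
  refine ⟨hmem, ?_⟩
  rw [one_div]
  refine HasDerivAt.of_local_left_inverse (h3.continuousAt (Icc_mem_nhds hs.1 hs.2)) (hd _ hmem)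
    (h0 _ hmem).ne' ?_
  filter_upwards [Icc_mem_nhds hs.1 hs.2] with y hy using (h1 y hy).2

/-- Gronwall in differential form, zero initial datum. -/
lemma gron {Φ Φ' : ℝ → ℝ} {c d K : ℝ} (hΦ : ContinuousOn Φ (Icc c d))
    (hd : ∀ x ∈ Ioo c d, HasDerivAt Φ (Φ' x) x) (h0 : ∀ x ∈ Ioo c d, Φ' x ≤ K * Φ x)
    (hc : Φ c = 0) (hnn : ∀ x ∈ Icc c d, 0 ≤ Φ x) : ∀ x ∈ Icc c d, Φ x = 0 := by
  intro x hx
  have := ends_ge (g := fun s => Φ s * Real.exp (-K * s))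
    (g' := fun s => Φ' s * Real.exp (-K * s) + Φ s * (Real.exp (-K * s) * (-K)))
    hx.1 (by
      refine ContinuousOn.mul (hΦ.mono (Icc_subset_Icc_right hx.2)) ?_
      fun_prop)
    (by
      intro s hs
      refine (hd s ⟨hs.1, hs.2.trans_le hx.2⟩).mul ?_
      have := ((hasDerivAt_id s).const_mul (-K)).exp
      simpa using this)
    (by
      intro s hs
      have h1 := h0 s ⟨hs.1, hs.2.trans_le hx.2⟩
      have h2 := Real.exp_pos (-K * s)
      nlinarith)
  simp only [hc, zero_mul] at this
  have h2 := Real.exp_pos (-K * x)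
  have h3 := hnn x hx
  nlinarith

end AnnU


namespace AnnU

/-- Everything we use about the nonlinearity. -/
structure FH (N : ℕ) (f F g : ℝ → ℝ) (β : ℝ) : Prop where
  hN : 1 ≤ N
  hβ : 1 < β
  dF : ∀ s, 0 < s → HasDerivAt F (f s) s
  cF : ContinuousOn F (Ici 0)
  cf : ContinuousOn f (Ici 0)
  F0 : F 0 = 0
  fpos : ∀ s, 1 < s → 0 < f s
  Fβ : F β = 0
  Fneg : ∀ s, 0 ≤ s → s ≤ β → F s ≤ 0
  Fpos : ∀ s, β < s → 0 < F s
  dG : ∀ s, 1 < s → HasDerivAt (fun t => F t / f t) (g s) s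
  hg : ∀ s, β ≤ s → (N : ℝ) - 1 ≤ 2 * ((N : ℝ) + 1) * g s
  f4 : ∀ x y, 1 ≤ x → x ≤ y → f x * (y - 1) ≤ f y * (x - 1)
  lip : ∀ c d, 0 < c → ∃ L : ℝ, 0 ≤ L ∧ ∀ x ∈ Icc c d, ∀ y ∈ Icc c d, |f x - f y| ≤ L * |x - y|

/-- The quadratic inequality behind (f3). -/
lemma quad_ineq (ν p q y : ℝ) (hν : 2 ≤ ν) (hq : 0 < q) (hqp : q < p) (hy : 0 ≤ y)
    (hcond :
      (2 < ν ∧ q ≤ 4 / (ν - 2) ∧ p ≤ (ν + 2) / (ν - 2)) ∨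
      (2 < ν ∧ 4 / (ν - 2) < q ∧
        q < (4 + Real.sqrt (2 * ν * (ν + 2))) / (2 * (ν - 2)) ∧
        p ≤ (2 * (q + 1) +
          Real.sqrt ((ν + 2) * (q + 1) * (ν + 2 - (ν - 2) * q))) / ν) ∨
      (ν = 2)) :
    0 ≤ ((ν + 2) * (p + 1) - 2 * ν * p) * y ^ 2 
      + 2 * (2 * (p + 1) - ν * q) * y * (p - q) + (ν + 2) * (p + 1) * (p - q) ^ 2 := by
  have hδ : 0 < p - q := sub_pos.2 hqp
  have hp0 : 0 < p := hq.trans hqp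
  have key : ∀ m, m = p + 1 → ν * m ^ 2 - (4 * q + 2 * ν + 4) * m + ν * q ^ 2 ≤ 0 → 
    0 ≤ ((ν + 2) * (p + 1) - 2 * ν * p) * y ^ 2 
      + 2 * (2 * (p + 1) - ν * q) * y * (p - q) + (ν + 2) * (p + 1) * (p - q) ^ 2 := by
    intro m hm h
    have e1 : p = m - 1 := by linarith
    have hC : 0 < (ν + 2) * m := by nlinarith
    -- discriminant
    have hD : (2 * m - ν * q) ^ 2 ≤ ((ν + 2) * m) * ((ν + 2) * m - 2 * ν * (m - 1)) := by
      nlinarith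
    have h2 : 0 ≤ ((ν + 2) * m) * (((ν + 2) * m - 2 * ν * (m - 1)) * y ^ 2 
      + 2 * (2 * m - ν * q) * y * (p - q) + (ν + 2) * m * (p - q) ^ 2) := by
      have : ((ν + 2) * m) * (((ν + 2) * m - 2 * ν * (m - 1)) * y ^ 2 
      + 2 * (2 * m - ν * q) * y * (p - q) + (ν + 2) * m * (p - q) ^ 2) =
        (((ν + 2) * m) * ((ν + 2) * m - 2 * ν * (m - 1)) - (2 * m - ν * q) ^ 2) * y ^ 2 +
        ((ν + 2) * m * (p - q) + (2 * m - ν * q) * y) ^ 2 := by ring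
      rw [this]
      have := mul_nonneg (sub_nonneg.2 hD) (sq_nonneg y)
      positivity
    have h3 := nonneg_of_mul_nonneg_right h2 hC
    rw [show m - 1 = p by linarith] at h3
    rw [← hm]
    exact h3
  rcases hcond with ⟨h2, h3, h4⟩ | ⟨h2, h3, h4, h5⟩ | h2
  · have hν2 : 0 < ν - 2 := by linarith
    rw [le_div_iff₀ hν2] at h3 h4
    rcases le_or_gt (ν * q) (2 * (p + 1)) with h | h
    · have a1 : 0 ≤ (ν + 2) * (p + 1) - 2 * ν * p := by nlinarith
      have a2 : 0 ≤ 2 * (p + 1) - ν * q := by linarith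
      positivity
    · refine key (p + 1) rfl ?_
      have e1 : 2 * (ν - 2) * q ^ 2 - 8 * q - (ν + 4) ≤ 0 := by nlinarith
      -- value at the two end points q+1, ν q /2
      have v1 : ν * (q + 1) ^ 2 - (4 * q + 2 * ν + 4) * (q + 1) + ν * q ^ 2 ≤ 0 := by nlinarith
      have v2 : ν * (ν * q / 2) ^ 2 - (4 * q + 2 * ν + 4) * (ν * q / 2) + ν * q ^ 2 ≤ 0 := by
        have : ν * (ν * q / 2) ^ 2 - (4 * q + 2 * ν + 4) * (ν * q / 2) + ν * q ^ 2
          = (ν * q * (ν + 2)) * ((q * (ν - 2)) / 4 - 1) := by ring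
        rw [this]
        apply mul_nonpos_of_nonneg_of_nonpos
        · positivity
        · linarith
      have w1 : 0 < p + 1 - (q + 1) := by linarith
      have w2 : 0 < ν * q / 2 - (p + 1) := by linarith
      have hL : 0 < ν * q / 2 - (q + 1) := by linarith
      have : (ν * q / 2 - (q + 1)) * (ν * (p + 1) ^ 2 - (4 * q + 2 * ν + 4) * (p + 1) + ν * q ^ 2) =
        (ν * q / 2 - (p + 1)) * (ν * (q + 1) ^ 2 - (4 * q + 2 * ν + 4) * (q + 1) + ν * q ^ 2) +
        (p + 1 - (q + 1)) * (ν * (ν * q / 2) ^ 2 - (4 * q + 2 * ν + 4) * (ν * q / 2) + ν * q ^ 2) -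
        ν * (p + 1 - (q + 1)) * (ν * q / 2 - (p + 1)) * (ν * q / 2 - (q + 1)) := by ring
      have u1 := mul_nonpos_of_nonneg_of_nonpos w2.le v1
      have u2 := mul_nonpos_of_nonneg_of_nonpos w1.le v2
      have u3 : 0 ≤ ν * (p + 1 - (q + 1)) * (ν * q / 2 - (p + 1)) * (ν * q / 2 - (q + 1)) := by
        positivity
      by_contra hcon
      push Not at hcon
      have := mul_pos hL hcon
      linarith
  · have hν2 : 0 < ν - 2 := by linarith
    refine key (p + 1) rfl ?_
    rw [lt_div_iff₀ (by linarith)] at h4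
    rw [le_div_iff₀ (by linarith)] at h5
    rw [div_lt_iff₀ hν2] at h3
    set A := Real.sqrt (2 * ν * (ν + 2)) with hA
    have hA2 : A ^ 2 = 2 * ν * (ν + 2) := Real.sq_sqrt (by positivity)
    have hA0 : 0 ≤ A := Real.sqrt_nonneg _
    have e1 : 2 * (ν - 2) * q ^ 2 - 8 * q - (ν + 4) ≤ 0 := by
      have : (2 * (ν - 2) * q - 4) ^ 2 ≤ A ^ 2 := by
        apply pow_le_pow_left₀ <;> nlinarith
      nlinarith
    have v1 : ν * (q + 1) ^ 2 - (4 * q + 2 * ν + 4) * (q + 1) + ν * q ^ 2 ≤ 0 := by nlinarith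
    have hnn : 0 ≤ (ν + 2) * (q + 1) * (ν + 2 - (ν - 2) * q) := by
      have : (ν + 2) * (q + 1) * (ν + 2 - (ν - 2) * q) = 
       (ν * (q + 1) - (2 * q + ν + 2)) ^ 2 - ν * (ν * (q + 1) ^ 2 - (4 * q + 2 * ν + 4) * (q + 1) + ν * q ^ 2) := by ring
      rw [this]
      nlinarith [sq_nonneg (ν * (q + 1) - (2 * q + ν + 2))]
    set D := Real.sqrt ((ν + 2) * (q + 1) * (ν + 2 - (ν - 2) * q)) with hDdef
    have hD2 : D ^ 2 = (ν + 2) * (q + 1) * (ν + 2 - (ν - 2) * q) := Real.sq_sqrt hnn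
    have hD0 : 0 ≤ D := Real.sqrt_nonneg _
    -- ν*quad(m) = (ν m - c)^2 - D^2
    have f1 : ν * (p + 1) - (2 * q + ν + 2) ≤ D := by linarith
    have f2 : - D ≤ ν * (q + 1) - (2 * q + ν + 2) := by
      have : (ν * (q + 1) - (2 * q + ν + 2)) ^ 2 ≤ D ^ 2 := by nlinarith
      exact (abs_le_of_sq_le_sq' this hD0).1
    have f3 : - D ≤ ν * (p + 1) - (2 * q + ν + 2) := by nlinarith
    have : (ν * (p + 1) - (2 * q + ν + 2)) ^ 2 ≤ D ^ 2 := sq_le_sq' f3 f1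
    have h6 : ν * (ν * (p + 1) ^ 2 - (4 * q + 2 * ν + 4) * (p + 1) + ν * q ^ 2) ≤ 0 := by
      nlinarith
    by_contra hcon
    push Not at hcon
    have := mul_pos (show (0:ℝ) < ν by linarith) hcon
    linarith
  · subst h2
    have a1 : 0 ≤ ((2:ℝ) + 2) * (p + 1) - 2 * 2 * p := by linarith
    have a2 : 0 ≤ 2 * (p + 1) - 2 * q := by linarith
    positivity

lemma fh_powers (N : ℕ) (hN : 1 ≤ N) (p q : ℝ) (hq : 0 < q) (hqp : q < p) (hp : 1 < p)
    (hcond :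
      (2 < (N:ℝ) + 1 ∧ q ≤ 4 / ((N:ℝ) + 1 - 2) ∧ p ≤ ((N:ℝ) + 1 + 2) / ((N:ℝ) + 1 - 2)) ∨
      (2 < (N:ℝ) + 1 ∧ 4 / ((N:ℝ) + 1 - 2) < q ∧
        q < (4 + Real.sqrt (2 * ((N:ℝ) + 1) * ((N:ℝ) + 1 + 2))) / (2 * ((N:ℝ) + 1 - 2)) ∧
        p ≤ (2 * (q + 1) +
          Real.sqrt (((N:ℝ) + 1 + 2) * (q + 1) * ((N:ℝ) + 1 + 2 - ((N:ℝ) + 1 - 2) * q))) / ((N:ℝ) + 1)) ∨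
      ((N:ℝ) + 1 = 2)) :
    ∃ F g β, FH N (fun s => s ^ p - s ^ q) F g β := by
  have hp0 : 0 < p := by linarith
  have hδ : 0 < p - q := by linarith
  set β : ℝ := ((p + 1) / (q + 1)) ^ (1 / (p - q)) with hβdef
  have hx0 : 1 < (p + 1) / (q + 1) := by rw [lt_div_iff₀ (by linarith)]; linarith
  have hβ1 : 1 < β := Real.one_lt_rpow hx0 (by positivity)
  have hβ0 : 0 < β := by linarith
  have hβx : β ^ (p - q) = (p + 1) / (q + 1) := by
    rw [hβdef, ← Real.rpow_mul (by positivity), one_div_mul_cancel hδ.ne', Real.rpow_one]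
  -- factorizations
  have hfac : ∀ s : ℝ, 0 < s → s ^ p = s ^ q * s ^ (p - q) := fun s hs => by
    rw [← Real.rpow_add hs]; congr 1; ring
  have hfac1 : ∀ s : ℝ, 0 < s → s ^ (p + 1) = s ^ (q + 1) * s ^ (p - q) := fun s hs => by
    rw [← Real.rpow_add hs]; congr 1; ring
  set f : ℝ → ℝ := fun s => s ^ p - s ^ q with hf
  set F : ℝ → ℝ := fun s => s ^ (p + 1) / (p + 1) - s ^ (q + 1) / (q + 1) with hF
  have hFx : ∀ s : ℝ, 0 < s → F s = s ^ (q + 1) * ((s ^ (p - q)) / (p + 1) - 1 / (q + 1)) := by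
    intro s hs
    simp only [hF]
    rw [hfac1 s hs]; ring
  have hfx : ∀ s : ℝ, 0 < s → f s = s ^ q * (s ^ (p - q) - 1) := by
    intro s hs
    simp only [hf]
    rw [hfac s hs]; ring
  have hfd : ∀ s : ℝ, 0 < s → HasDerivAt f (p * s ^ (p - 1) - q * s ^ (q - 1)) s := fun s hs =>
    (Real.hasDerivAt_rpow_const (Or.inl hs.ne')).sub (Real.hasDerivAt_rpow_const (Or.inl hs.ne'))
  have hFd : ∀ s : ℝ, 0 < s → HasDerivAt F (f s) s := by
    intro s hs
    have h1 := (Real.hasDerivAt_rpow_const (p := p + 1) (Or.inl hs.ne')).div_const (p + 1)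
    have h2 := (Real.hasDerivAt_rpow_const (p := q + 1) (Or.inl hs.ne')).div_const (q + 1)
    refine (h1.sub h2).congr_deriv ?_
    simp only [hf, add_sub_cancel_right]
    rw [mul_div_cancel_left₀ _ (by linarith), mul_div_cancel_left₀ _ (by linarith)]
  have hfpos : ∀ s, 1 < s → 0 < f s := fun s hs => sub_pos.2 (Real.rpow_lt_rpow_of_exponent_lt hs hqp)
  have hmono : ∀ s t : ℝ, 0 ≤ s → s ≤ t → s ^ (p - q) ≤ t ^ (p - q) := fun s t h1 h2 =>
    Real.rpow_le_rpow h1 h2 hδ.le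
  have hcf : Continuous f := 
    (Real.continuous_rpow_const hp0.le).sub (Real.continuous_rpow_const hq.le)
  have hcF : Continuous F :=
    ((Real.continuous_rpow_const (by linarith)).div_const _).sub
      ((Real.continuous_rpow_const (by linarith)).div_const _)
  set g : ℝ → ℝ := fun s => (f s * f s - F s * (p * s ^ (p - 1) - q * s ^ (q - 1))) / f s ^ 2 with hg
  refine ⟨F, g, β, hN, hβ1, hFd, hcF.continuousOn, hcf.continuousOn, ?_, hfpos, ?_, ?_, ?_, ?_, ?_,
    ?_, ?_⟩
  · simp only [hF]
    rw [Real.zero_rpow (by linarith), Real.zero_rpow (by linarith)]; simp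
  · rw [hFx β hβ0, hβx]; field_simp; ring
  · intro s h0 h1
    rcases h0.eq_or_lt with h | h
    · simp only [hF]; rw [← h, Real.zero_rpow (by linarith), Real.zero_rpow (by linarith)]; simp
    · rw [hFx s h]
      have := hmono s β h0 h1
      rw [hβx] at this
      apply mul_nonpos_of_nonneg_of_nonpos (by positivity)
      rw [sub_nonpos, div_le_iff₀ (by linarith)]
      calc _ ≤ _ := this
        _ = _ := by ring
  · intro s h1
    have h : 0 < s := by linarith
    rw [hFx s h]
    have := Real.rpow_lt_rpow hβ0.le h1 hδ
    rw [hβx] at this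
    apply mul_pos (by positivity)
    rw [sub_pos, lt_div_iff₀ (by linarith)]
    calc _ = _ := by ring
      _ < _ := this
  · intro s hs
    exact (hFd s (by linarith)).div (hfd s (by linarith)) (hfpos s hs).ne'
  · intro s hs
    have h0 : 0 < s := by linarith
    have h1 : 1 < s := by linarith
    have hff := hfpos s h1
    simp only [hg]
    rw [← mul_div_assoc, le_div_iff₀ (by positivity)]
    have hy := hmono β s hβ0.le hs
    rw [hβx] at hy
    set x := s ^ (p - q) with hx
    have hsq : s ^ q * s ^ q = s ^ (q + 1) * s ^ (q - 1) := by
      rw [← Real.rpow_add h0, ← Real.rpow_add h0]; congr 1; ring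
    have hp1 : s ^ (p - 1) = s ^ (q - 1) * x := by
      rw [hx, ← Real.rpow_add h0]; congr 1; ring
    have Q := quad_ineq ((N:ℝ) + 1) p q ((x - (p + 1) / (q + 1)) * (q + 1)) 
      (by have : (1:ℝ) ≤ N := by exact_mod_cast hN
          linarith) hq hqp (mul_nonneg (by linarith) (by linarith)) hcond
    rw [hFx s h0, hfx s h0, hp1]
    have e : 0 ≤ (s ^ q * s ^ q) * ((((N:ℝ) + 1 + 2) * (x - 1) ^ 2 - 2 * ((N:ℝ)+1) * ((x / (p + 1) - 1 / (q + 1)) * (p * x - q)))) := by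
      apply mul_nonneg (by positivity)
      have h2 : ((((N:ℝ) + 1 + 2) * (x - 1) ^ 2 - 2 * ((N:ℝ)+1) * ((x / (p + 1) - 1 / (q + 1)) * (p * x - q)))) = 
        ((((N:ℝ) + 1 + 2) * (p + 1) - 2 * ((N:ℝ) + 1) * p) * ((x - (p + 1) / (q + 1)) * (q + 1)) ^ 2 +
        2 * (2 * (p + 1) - ((N:ℝ) + 1) * q) * ((x - (p + 1) / (q + 1)) * (q + 1)) * (p - q) +
        ((N:ℝ) + 1 + 2) * (p + 1) * (p - q) ^ 2) / ((p + 1) * (q + 1) ^ 2) := by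
        field_simp
        ring
      rw [h2]
      positivity
    have e2 : 2 * ((N:ℝ) + 1) * (s ^ q * (x - 1) * (s ^ q * (x - 1)) - s ^ (q + 1) * (x / (p + 1) - 1 / (q + 1)) * (p * (s ^ (q - 1) * x) - q * s ^ (q - 1))) - ((N:ℝ) - 1) * (s ^ q * (x - 1)) ^ 2 = 
      (s ^ q * s ^ q) * (((N:ℝ) + 3) * (x - 1) ^ 2) - (s ^ (q + 1) * s ^ (q - 1)) * (2 * ((N:ℝ)+1) * ((x / (p + 1) - 1 / (q + 1)) * (p * x - q))) := by ring
    rw [← hsq] at e2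
    nlinarith [e, e2]
  · -- f4 
    have hconv : ConvexOn ℝ (Ici 1) f := by
      refine convexOn_of_hasDerivWithinAt2_nonneg (convex_Ici 1) hcf.continuousOn 
        (f' := fun s => p * s ^ (p - 1) - q * s ^ (q - 1)) 
        (f'' := fun s => p * ((p - 1) * s ^ (p - 1 - 1)) - q * ((q - 1) * s ^ (q - 1 - 1))) ?_ ?_ ?_
      · rw [interior_Ici]
        exact fun s hs => (hfd s (lt_trans one_pos hs)).hasDerivWithinAt
      · rw [interior_Ici]
        intro s hs
        have hs0 : s ≠ 0 := (lt_trans one_pos hs).ne'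
        exact (((Real.hasDerivAt_rpow_const (Or.inl hs0)).const_mul p).sub 
          ((Real.hasDerivAt_rpow_const (Or.inl hs0)).const_mul q)).hasDerivWithinAt
      · rw [interior_Ici]
        intro s hs
        have hs0 : 0 < s := (lt_trans one_pos hs)
        have h1 : s ^ (q - 1 - 1) ≤ s ^ (p - 1 - 1) := 
          Real.rpow_le_rpow_of_exponent_le (le_of_lt hs) (by linarith)
        have h2 : 0 < s ^ (q - 1 - 1) := Real.rpow_pos_of_pos hs0 _
        have h3 : q * (q - 1) ≤ p * (p - 1) := by nlinarith
        have h4 : 0 < p * (p - 1) := by nlinarith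
        have h5 := mul_le_mul_of_nonneg_left h1 h4.le
        have h6 := mul_le_mul_of_nonneg_right h3 h2.le
        nlinarith
    intro x y hx hxy
    rcases hx.eq_or_lt with h | h
    · subst h; simp [hf]
    rcases hxy.eq_or_lt with h' | h'
    · subst h'; exact le_rfl
    have hf1 : f 1 = 0 := by simp [hf]
    have := hconv.secant_mono (a := 1) (x := x) (y := y) (mem_Ici.2 le_rfl) (mem_Ici.2 hx) (mem_Ici.2 (hx.trans hxy)) 
      h.ne' (h.trans h').ne' hxy
    rw [hf1, sub_zero, sub_zero, div_le_div_iff₀ (by linarith) (by linarith)] at this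
    exact this
  · intro c d hc
    have hcont : ContinuousOn (fun s : ℝ => p * s ^ (p - 1) - q * s ^ (q - 1)) (Icc c d) := by
      intro s hs
      have hs0 : s ≠ 0 := (hc.trans_le hs.1).ne'
      exact (((Real.continuousAt_rpow_const _ _ (Or.inl hs0)).const_mul p).sub
        ((Real.continuousAt_rpow_const _ _ (Or.inl hs0)).const_mul q)).continuousWithinAt
    obtain ⟨L, hL⟩ := isCompact_Icc.exists_bound_of_continuousOn hcont
    refine ⟨max L 0, le_max_right _ _, fun x hx y hy => ?_⟩
    have := (convex_Icc c d).norm_image_sub_le_of_norm_hasDerivWithin_le (f := f) (C := max L 0)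
      (fun s hs => (hfd s (hc.trans_le hs.1)).hasDerivWithinAt) 
      (fun s hs => (hL s hs).trans (le_max_left _ _)) hy hx
    simpa [Real.norm_eq_abs] using this

end AnnU


namespace AnnU

/-- A monotone branch of a solution, parametrized by its value `s`: `r s` is the radius and
`p s = |u'|`. -/
structure Br (N : ℕ) (f F : ℝ → ℝ) (β ε M : ℝ) (r p : ℝ → ℝ) : Prop where
  hM : β < M
  cr : ContinuousOn r (Icc 0 M)
  cp : ContinuousOn p (Icc 0 M)
  rpos : ∀ s ∈ Icc 0 M, 0 < r s
  ppos : ∀ s ∈ Ioo 0 M, 0 < p s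
  p0 : 0 ≤ p 0
  pM : p M = 0
  dr : ∀ s ∈ Ioo 0 M, HasDerivAt r (ε / p s) s
  dp : ∀ s ∈ Ioo 0 M, HasDerivAt p (-(ε * N / r s) - f s / p s) s
  Epos : ∀ s ∈ Ioc 0 M, 0 < p s ^ 2 + 2 * F s

section
variable {N : ℕ} {f F g : ℝ → ℝ} {β ε M : ℝ} {r p : ℝ → ℝ}

lemma Br.dz (H : FH N f F g β) (B : Br N f F β ε M r p) {s : ℝ} (hs : s ∈ Ioo 0 M) :
    HasDerivAt (fun s => r s ^ N * p s) (-(r s ^ N * f s / p s)) s := by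
  have h1 := ((B.dr s hs).pow N).mul (B.dp s hs)
  refine h1.congr_deriv ?_
  have hr := B.rpos s (Ioo_subset_Icc_self hs)
  have hp := B.ppos s hs
  obtain ⟨k, rfl⟩ : ∃ k, N = k + 1 := ⟨N - 1, by have := H.hN; omega⟩
  simp only [Nat.add_sub_cancel, Pi.pow_apply]
  field_simp
  ring

lemma Br.dz2 (H : FH N f F g β) (B : Br N f F β ε M r p) {s : ℝ} (hs : s ∈ Ioo 0 M) :
    HasDerivAt (fun s => (r s ^ N * p s) ^ 2) (-(2 * (r s ^ N) ^ 2 * f s)) s := by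
  refine ((B.dz H hs).pow 2).congr_deriv ?_
  have hp := B.ppos s hs
  simp only [Nat.cast_ofNat]
  field_simp
  rw [show (2 - 1 : ℕ) = 1 from rfl, pow_one]
  ring

lemma Br.dE (H : FH N f F g β) (B : Br N f F β ε M r p) {s : ℝ} (hs : s ∈ Ioo 0 M) :
    HasDerivAt (fun s => p s ^ 2 + 2 * F s) (-(2 * ε * N * p s / r s)) s := by
  refine (((B.dp s hs).pow 2).add ((H.dF s hs.1).const_mul 2)).congr_deriv ?_
  have hp := B.ppos s hs
  have hr := B.rpos s (Ioo_subset_Icc_self hs)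
  simp only [Nat.cast_ofNat]
  field_simp
  ring

lemma Br.dA (H : FH N f F g β) (B : Br N f F β ε M r p) {s : ℝ} (hs : s ∈ Ioo 0 M) :
    HasDerivAt (fun s => r s ^ (N + 1) * (p s ^ 2 + 2 * F s))
      (ε * r s ^ N * ((1 - N) * p s ^ 2 + 2 * (N + 1) * F s) / p s) s := by
  refine (((B.dr s hs).pow (N + 1)).mul (B.dE H hs)).congr_deriv ?_
  have hp := B.ppos s hs
  have hr := B.rpos s (Ioo_subset_Icc_self hs)
  simp only [Nat.add_sub_cancel, Pi.pow_apply]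
  push_cast
  field_simp
  ring

lemma Br.dP (H : FH N f F g β) (B : Br N f F β ε M r p) {s : ℝ} (hs : s ∈ Ioo 0 M) (h1 : 1 < s) :
    HasDerivAt (fun s => -(2 * ε * (N + 1)) * (F s / f s) * (r s ^ N * p s)
      - r s ^ (N + 1) * (p s ^ 2 + 2 * F s))
      (-ε * (2 * (N + 1) * g s - (N - 1)) * (r s ^ N * p s)) s := by
  refine ((((H.dG s h1).const_mul (-(2 * ε * (N + 1)))).mul (B.dz H hs)).sub
    (B.dA H hs)).congr_deriv ?_
  have hp := B.ppos s hs
  have hf := H.fpos s h1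
  field_simp
  ring

lemma Br.sub {c d : ℝ} (_B : Br N f F β ε M r p) (hc : 0 ≤ c) (hd : d ≤ M) :
    Icc c d ⊆ Icc 0 M := Icc_subset_Icc hc hd

lemma Br.cz {c d : ℝ} (B : Br N f F β ε M r p) (hc : 0 ≤ c) (hd : d ≤ M) :
    ContinuousOn (fun s => r s ^ N * p s) (Icc c d) :=
  (((B.cr).pow N).mul B.cp).mono (B.sub hc hd)

lemma Br.cE {c d : ℝ} (H : FH N f F g β) (B : Br N f F β ε M r p) (hc : 0 ≤ c) (hd : d ≤ M) :
    ContinuousOn (fun s => p s ^ 2 + 2 * F s) (Icc c d) :=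
  ((B.cp.mono (B.sub hc hd)).pow 2).add
    ((H.cF.mono (fun _ hx => mem_Ici.2 (hc.trans hx.1))).const_smul (2:ℝ))

lemma Br.cA {c d : ℝ} (H : FH N f F g β) (B : Br N f F β ε M r p) (hc : 0 ≤ c) (hd : d ≤ M) :
    ContinuousOn (fun s => r s ^ (N + 1) * (p s ^ 2 + 2 * F s)) (Icc c d) :=
  ((B.cr.mono (B.sub hc hd)).pow (N + 1)).mul (B.cE H hc hd)

lemma Br.cP {c d : ℝ} (H : FH N f F g β) (B : Br N f F β ε M r p) (hc : 1 < c) (hd : d ≤ M) :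
    ContinuousOn (fun s => -(2 * ε * (N + 1)) * (F s / f s) * (r s ^ N * p s)
      - r s ^ (N + 1) * (p s ^ 2 + 2 * F s)) (Icc c d) := by
  refine ContinuousOn.sub (ContinuousOn.mul ?_ (B.cz (by linarith) hd)) (B.cA H (by linarith) hd)
  refine ContinuousOn.mul continuousOn_const ?_
  intro s hs
  exact (H.dG s (by linarith [hs.1])).continuousAt.continuousWithinAt

lemma Br.pnn (B : Br N f F β ε M r p) {s : ℝ} (hs : s ∈ Icc 0 M) : 0 ≤ p s := by
  rcases hs.1.eq_or_lt with h | h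
  · rw [← h]; exact B.p0
  rcases hs.2.eq_or_lt with h' | h'
  · rw [h', B.pM]
  · exact (B.ppos s ⟨h, h'⟩).le

end

section
variable {N : ℕ} {f F g : ℝ → ℝ} {β M₁ M₂ : ℝ} {r₁ p₁ r₂ p₂ : ℝ → ℝ}

lemma dY (H : FH N f F g β) {M : ℝ} {r p : ℝ → ℝ} (B : Br N f F β 1 M r p) {s : ℝ}
    (hs : s ∈ Ioo 0 M) :
    HasDerivAt (fun s => r s * (p s ^ 2 + 2 * F s) ^ (1 / (2 * (N:ℝ))))
      (2 * F s * ((p s ^ 2 + 2 * F s) ^ (1 / (2 * (N:ℝ)) - 1) / p s)) s := by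
  have hE := B.Epos s ⟨hs.1, hs.2.le⟩
  have hp := B.ppos s hs
  have hr := B.rpos s (Ioo_subset_Icc_self hs)
  have hN : (0:ℝ) < N := by exact_mod_cast H.hN
  refine ((B.dr s hs).mul ((B.dE H hs).rpow_const (p := 1 / (2 * (N:ℝ))) (Or.inl hE.ne'))).congr_deriv ?_
  have e : (p s ^ 2 + 2 * F s) ^ (1 / (2 * (N:ℝ))) =
    (p s ^ 2 + 2 * F s) ^ (1 / (2 * (N:ℝ)) - 1) * (p s ^ 2 + 2 * F s) := by
    rw [← Real.rpow_add_one hE.ne']; congr 1; ring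
  rw [e]
  field_simp
  ring

lemma inc_low_step (H : FH N f F g β) (B₁ : Br N f F β 1 M₁ r₁ p₁) (B₂ : Br N f F β 1 M₂ r₂ p₂)
    (h0 : r₁ 0 = r₂ 0) (hp1 : 0 < p₁ 0) (hp : p₁ 0 < p₂ 0) {e : ℝ} (he : e ∈ Ioc 0 β)
    (hlt : ∀ s ∈ Ico 0 e, p₁ s < p₂ s) :
    r₂ e < r₁ e ∧ r₁ e * (p₁ e ^ 2 + 2 * F e) ^ (1 / (2 * (N:ℝ))) <
      r₂ e * (p₂ e ^ 2 + 2 * F e) ^ (1 / (2 * (N:ℝ))) := by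
  have hN : (1:ℝ) ≤ N := by exact_mod_cast H.hN
  have hM₁ := B₁.hM
  have hM₂ := B₂.hM
  have heβ := he.2
  have m1 : ∀ s ∈ Ioo 0 e, s ∈ Ioo 0 M₁ := fun s hs => ⟨hs.1, by linarith [hs.2]⟩
  have m2 : ∀ s ∈ Ioo 0 e, s ∈ Ioo 0 M₂ := fun s hs => ⟨hs.1, by linarith [hs.2]⟩
  have hκ0 : 0 < 1 / (2 * (N:ℝ)) := by positivity
  have hκ1 : 1 / (2 * (N:ℝ)) - 1 ≤ 0 := by
    rw [sub_nonpos, div_le_iff₀ (by positivity)]; linarith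
  constructor
  · have := ends_lt (g := fun s => r₁ s - r₂ s) he.1
      ((B₁.cr.mono (B₁.sub le_rfl (by linarith))).sub (B₂.cr.mono (B₂.sub le_rfl (by linarith))))
      (fun s hs => (B₁.dr s (m1 s hs)).sub (B₂.dr s (m2 s hs)))
      (fun s hs => by
        have a := B₁.ppos s (m1 s hs)
        have := one_div_lt_one_div_of_lt a (hlt s ⟨hs.1.le, hs.2⟩)
        linarith)
    simp only [h0, sub_self] at this
    linarith
  · have hc : ∀ {M : ℝ} {r p : ℝ → ℝ}, Br N f F β 1 M r p → ContinuousOn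
        (fun s => r s * (p s ^ 2 + 2 * F s) ^ (1 / (2 * (N:ℝ)))) (Icc 0 e) := by
      intro M r p B
      have := B.hM
      exact (B.cr.mono (B.sub le_rfl (by linarith))).mul
        ((B.cE H le_rfl (by linarith)).rpow_const (fun x hx => Or.inr hκ0.le))
    have := ends_le (g := fun s => r₂ s * (p₂ s ^ 2 + 2 * F s) ^ (1 / (2 * (N:ℝ))) -
        r₁ s * (p₁ s ^ 2 + 2 * F s) ^ (1 / (2 * (N:ℝ)))) he.1.le
      ((hc B₂).sub (hc B₁)) (fun s hs => (dY H B₂ (m2 s hs)).sub (dY H B₁ (m1 s hs)))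
      (fun s hs => by
        have a1 := B₁.ppos s (m1 s hs)
        have a := (hlt s ⟨hs.1.le, hs.2⟩)
        have b1 := B₁.Epos s ⟨(m1 s hs).1, (m1 s hs).2.le⟩
        have b : p₁ s ^ 2 + 2 * F s ≤ p₂ s ^ 2 + 2 * F s := by nlinarith
        have c := Real.rpow_le_rpow_of_nonpos b1 b hκ1
        have d := div_le_div₀ (Real.rpow_nonneg b1.le (1 / (2 * (N:ℝ)) - 1)) c a1 a.le
        have := H.Fneg s hs.1.le (by linarith [hs.2])
        nlinarith)
    simp only [H.F0, h0] at this
    have h2 : r₂ 0 * (p₁ 0 ^ 2 + 2 * 0) ^ (1 / (2 * (N:ℝ))) <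
        r₂ 0 * (p₂ 0 ^ 2 + 2 * 0) ^ (1 / (2 * (N:ℝ))) := by
      apply mul_lt_mul_of_pos_left _ (B₂.rpos 0 ⟨le_rfl, by linarith [H.hβ]⟩)
      apply Real.rpow_lt_rpow (by positivity) _ hκ0
      nlinarith
    linarith

lemma inc_low (H : FH N f F g β) (B₁ : Br N f F β 1 M₁ r₁ p₁) (B₂ : Br N f F β 1 M₂ r₂ p₂)
    (h0 : r₁ 0 = r₂ 0) (hp1 : 0 < p₁ 0) (hp : p₁ 0 < p₂ 0) :
    (∀ s ∈ Ioc 0 β, r₂ s < r₁ s) ∧ r₁ β ^ N * p₁ β < r₂ β ^ N * p₂ β := by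
  have hN : (1:ℝ) ≤ N := by exact_mod_cast H.hN
  have hM₁ := B₁.hM
  have hM₂ := B₂.hM
  have hβ := H.hβ
  have hall : ∀ s ∈ Icc 0 β, 0 < p₂ s - p₁ s := by
    by_contra hcon
    obtain ⟨e, he, h1, h2⟩ := contact_up ((B₂.cp.mono (B₂.sub le_rfl hM₂.le)).sub
      (B₁.cp.mono (B₁.sub le_rfl hM₁.le))) (sub_pos.2 hp) hcon
    obtain ⟨h3, h4⟩ := inc_low_step H B₁ B₂ h0 hp1 hp he (fun s hs => sub_pos.1 (h2 s hs))
    have h5 : p₂ e = p₁ e := by simpa [sub_eq_zero] using h1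
    rw [h5] at h4
    have h6 := B₁.Epos e ⟨he.1, by linarith [he.2]⟩
    have h7 := Real.rpow_pos_of_pos h6 (1 / (2 * (N:ℝ)))
    have := lt_of_mul_lt_mul_right h4 h7.le
    linarith
  have hst : ∀ e ∈ Ioc 0 β, _ := fun e he => inc_low_step H B₁ B₂ h0 hp1 hp he
    (fun s hs => sub_pos.1 (hall s ⟨hs.1, hs.2.le.trans he.2⟩))
  refine ⟨fun s hs => (hst s hs).1, ?_⟩
  have h1 := (hst β ⟨by linarith, le_rfl⟩).2
  rw [H.Fβ, mul_zero, add_zero, add_zero] at h1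
  have k : ∀ x y : ℝ, 0 ≤ x → 0 ≤ y → (x * (y ^ 2) ^ (1 / (2 * (N:ℝ)))) ^ N = x ^ N * y := by
    intro x y hx hy
    rw [mul_pow, ← Real.rpow_natCast (_ ^ _), ← Real.rpow_mul (by positivity),
      ← Real.rpow_natCast y 2, ← Real.rpow_mul hy]
    congr 1
    have : (((2:ℕ):ℝ) * (1 / (2 * (N:ℝ)) * N)) = 1 := by push_cast; field_simp
    rw [this, Real.rpow_one]
  have a1 := (B₁.rpos β ⟨by linarith, hM₁.le⟩).le
  have a2 := (B₂.rpos β ⟨by linarith, hM₂.le⟩).le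
  have b1 := B₁.pnn (s := β) ⟨by linarith, hM₁.le⟩
  have b2 := B₂.pnn (s := β) ⟨by linarith, hM₂.le⟩
  rw [← k _ _ a1 b1, ← k _ _ a2 b2]
  exact pow_lt_pow_left₀ h1 (by positivity) (by have := H.hN; omega)

/-- Full comparison on the increasing branch. -/
lemma inc_full (H : FH N f F g β) (B₁ : Br N f F β 1 M₁ r₁ p₁) (B₂ : Br N f F β 1 M₂ r₂ p₂)
    (h0 : r₁ 0 = r₂ 0) (hp1 : 0 < p₁ 0) (hp : p₁ 0 < p₂ 0) :
    M₁ < M₂ ∧ (∀ s ∈ Ioc 0 M₁, r₂ s < r₁ s) ∧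
      (∀ s ∈ Icc β M₁, r₁ s ^ N * p₁ s < r₂ s ^ N * p₂ s) := by
  obtain ⟨hr, hz⟩ := inc_low H B₁ B₂ h0 hp1 hp
  have hM₁ := B₁.hM
  have hM₂ := B₂.hM
  have hβ := H.hβ
  set m := min M₁ M₂ with hm
  have hm1 : m ≤ M₁ := min_le_left _ _
  have hm2 : m ≤ M₂ := min_le_right _ _
  have hmβ : β < m := lt_min hM₁ hM₂
  have step : ∀ e ∈ Icc β m, (∀ s ∈ Ico β e, 0 < r₁ s - r₂ s) →
      r₁ e ^ N * p₁ e < r₂ e ^ N * p₂ e := by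
    intro e he hlt
    have := ends_le (g := fun s => (r₂ s ^ N * p₂ s) ^ 2 - (r₁ s ^ N * p₁ s) ^ 2) he.1
      (((B₂.cz (by linarith) (by linarith [he.2])).pow 2).sub
        ((B₁.cz (by linarith) (by linarith [he.2])).pow 2))
      (fun s hs => (B₂.dz2 H ⟨by linarith [hs.1], by linarith [hs.2, he.2]⟩).sub
        (B₁.dz2 H ⟨by linarith [hs.1], by linarith [hs.2, he.2]⟩))
      (fun s hs => by
        have a := hlt s ⟨hs.1.le, hs.2⟩
        have b := H.fpos s (by linarith [hs.1])
        have c := B₂.rpos s ⟨by linarith [hs.1], by linarith [hs.2, he.2]⟩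
        have d : (r₂ s ^ N) ^ 2 ≤ (r₁ s ^ N) ^ 2 := by
          apply pow_le_pow_left₀ (by positivity)
          apply pow_le_pow_left₀ c.le; linarith
        nlinarith)
    have a1 := B₁.pnn (s := β) ⟨by linarith, hM₁.le⟩
    have a2 := B₂.pnn (s := e) ⟨by linarith [he.1], by linarith [he.2]⟩
    have b1 := B₁.rpos β ⟨by linarith, hM₁.le⟩
    have b2 := B₂.rpos e ⟨by linarith [he.1], by linarith [he.2]⟩
    have c1 : 0 ≤ r₁ β ^ N * p₁ β := by positivity
    have c2 : 0 ≤ r₂ e ^ N * p₂ e := by positivity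
    refine lt_of_pow_lt_pow_left₀ 2 c2 ?_
    have := pow_lt_pow_left₀ hz c1 (two_ne_zero)
    linarith
  have hall : ∀ s ∈ Icc β m, 0 < r₁ s - r₂ s := by
    by_contra hcon
    obtain ⟨e, he, h1, h2⟩ := contact_up (g := fun s => r₁ s - r₂ s) ((B₁.cr.mono (B₁.sub (by linarith) hm1)).sub
      (B₂.cr.mono (B₂.sub (by linarith) hm2))) (sub_pos.2 (hr β ⟨by linarith, le_rfl⟩)) hcon
    have := ends_le (g := fun s => r₁ s - r₂ s) he.1.le
      ((B₁.cr.mono (B₁.sub (by linarith) (by linarith [he.2]))).sub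
        (B₂.cr.mono (B₂.sub (by linarith) (by linarith [he.2]))))
      (fun s hs => (B₁.dr s ⟨by linarith [hs.1], by linarith [hs.2, he.2]⟩).sub
        (B₂.dr s ⟨by linarith [hs.1], by linarith [hs.2, he.2]⟩))
      (fun s hs => by
        have a := step s ⟨hs.1.le, by linarith [hs.2, he.2]⟩ (fun t ht => h2 t ⟨ht.1, ht.2.trans hs.2⟩)
        have b := h2 s ⟨hs.1.le, hs.2⟩
        have c := B₂.rpos s ⟨by linarith [hs.1], by linarith [hs.2, he.2]⟩
        have d : r₂ s ^ N ≤ r₁ s ^ N := pow_le_pow_left₀ c.le (by linarith) _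
        have p1 := B₁.ppos s ⟨by linarith [hs.1], by linarith [hs.2, he.2]⟩
        have p2 := B₂.ppos s ⟨by linarith [hs.1], by linarith [hs.2, he.2]⟩
        have : p₁ s < p₂ s := by
          have h3 : r₂ s ^ N * p₁ s < r₂ s ^ N * p₂ s :=
            lt_of_le_of_lt (mul_le_mul_of_nonneg_right d p1.le) a
          exact lt_of_mul_lt_mul_left h3 (by positivity)
        have := one_div_lt_one_div_of_lt p1 this
        linarith)
    have h3 := hr β ⟨by linarith, le_rfl⟩
    linarith
  have hzall : ∀ s ∈ Icc β m, r₁ s ^ N * p₁ s < r₂ s ^ N * p₂ s := fun s hs =>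
    step s hs (fun t ht => hall t ⟨ht.1, ht.2.le.trans hs.2⟩)
  have hlt : M₁ < M₂ := by
    by_contra hcon
    have e : m = M₂ := min_eq_right (not_lt.1 hcon)
    have := hzall M₂ ⟨hM₂.le, e.ge⟩
    rw [B₂.pM, mul_zero] at this
    have a1 := B₁.pnn (s := M₂) ⟨by linarith, by linarith⟩
    have b1 := B₁.rpos M₂ ⟨by linarith, by linarith⟩
    have : 0 ≤ r₁ M₂ ^ N * p₁ M₂ := by positivity
    linarith
  have e : m = M₁ := min_eq_left hlt.le
  rw [e] at hall hzall
  refine ⟨hlt, fun s hs => ?_, hzall⟩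
  rcases le_total s β with h | h
  · exact hr s ⟨hs.1, h⟩
  · exact sub_pos.1 (hall s ⟨h, hs.2⟩)

end
end AnnU


namespace AnnU

section
variable {N : ℕ} {f F g : ℝ → ℝ} {β M₁ M₂ : ℝ} {r₁ p₁ r₂ p₂ : ℝ → ℝ}

lemma dW (H : FH N f F g β) {M : ℝ} {r p : ℝ → ℝ} (B : Br N f F β (-1) M r p) {s : ℝ}
    (hs : s ∈ Ioo 0 M) :
    HasDerivAt (fun s => r s * Real.sqrt (p s ^ 2 + 2 * F s))
      (((N - 1) * p s ^ 2 - 2 * F s) / (p s * Real.sqrt (p s ^ 2 + 2 * F s))) s := by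
  have hE := B.Epos s ⟨hs.1, hs.2.le⟩
  have hp := B.ppos s hs
  have hr := B.rpos s (Ioo_subset_Icc_self hs)
  refine ((B.dr s hs).mul ((B.dE H hs).sqrt hE.ne')).congr_deriv ?_
  have hq := Real.sqrt_pos.2 hE
  have hq2 := Real.sq_sqrt hE.le
  set q := Real.sqrt (p s ^ 2 + 2 * F s)
  field_simp
  rw [hq2]
  ring

lemma cW (H : FH N f F g β) {M c d : ℝ} {r p : ℝ → ℝ} (B : Br N f F β (-1) M r p)
    (hc : 0 ≤ c) (hd : d ≤ M) :
    ContinuousOn (fun s => r s * Real.sqrt (p s ^ 2 + 2 * F s)) (Icc c d) :=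
  (B.cr.mono (B.sub hc hd)).mul (B.cE H hc hd).sqrt

lemma W_ineq {k p₁ p₂ q₁ q₂ F : ℝ} (hk : 0 ≤ k) (h1 : 0 < p₁) (h12 : p₁ < p₂) (hF : F ≤ 0)
    (hq1 : 0 < q₁) (hq2 : 0 < q₂) (e1 : q₁ ^ 2 = p₁ ^ 2 + 2 * F) (e2 : q₂ ^ 2 = p₂ ^ 2 + 2 * F) :
    (k * p₂ ^ 2 - 2 * F) / (p₂ * q₂) ≤ (k * p₁ ^ 2 - 2 * F) / (p₁ * q₁) := by
  have h2 : 0 < p₂ := h1.trans h12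
  have hsq : p₁ ^ 2 < p₂ ^ 2 := by nlinarith
  have hq : q₁ < q₂ := lt_of_pow_lt_pow_left₀ 2 hq2.le (by rw [e1, e2]; linarith)
  have a : p₂ * q₁ ≤ p₁ * q₂ := by
    refine le_of_sq_le_sq ?_ (by positivity) |>.trans le_rfl
    rw [mul_pow, mul_pow, e1, e2]; nlinarith
  have b : p₁ * q₁ ≤ p₂ * q₂ := by nlinarith
  rw [div_le_div_iff₀ (by positivity) (by positivity)]
  have c : k * (p₂ * p₁) * (p₂ * q₁) ≤ k * (p₂ * p₁) * (p₁ * q₂) :=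
    mul_le_mul_of_nonneg_left a (by positivity)
  have d : (-(2 * F)) * (p₁ * q₁) ≤ (-(2 * F)) * (p₂ * q₂) :=
    mul_le_mul_of_nonneg_left b (by linarith)
  linarith

lemma final_step (H : FH N f F g β) (D₁ : Br N f F β (-1) M₁ r₁ p₁)
    (D₂ : Br N f F β (-1) M₂ r₂ p₂) {s0 c : ℝ} (hs0 : s0 ∈ Ioc 0 β) (hr : r₂ s0 ≤ r₁ s0)
    (hW : r₁ s0 * Real.sqrt (p₁ s0 ^ 2 + 2 * F s0) < r₂ s0 * Real.sqrt (p₂ s0 ^ 2 + 2 * F s0))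
    (hc : c ∈ Ico 0 s0) (hlt : ∀ s ∈ Ioc c s0, p₁ s < p₂ s) :
    r₂ c < r₁ c ∧
      r₁ c * Real.sqrt (p₁ c ^ 2 + 2 * F c) < r₂ c * Real.sqrt (p₂ c ^ 2 + 2 * F c) := by
  have hM₁ := D₁.hM
  have hM₂ := D₂.hM
  have hN : (1:ℝ) ≤ N := by exact_mod_cast H.hN
  have hc0 := hc.1
  have hsβ := hs0.2
  have m1 : ∀ s ∈ Ioo c s0, s ∈ Ioo 0 M₁ := fun s hs => ⟨by linarith [hs.1], by linarith [hs.2]⟩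
  have m2 : ∀ s ∈ Ioo c s0, s ∈ Ioo 0 M₂ := fun s hs => ⟨by linarith [hs.1], by linarith [hs.2]⟩
  constructor
  · have := ends_gt (g := fun s => r₁ s - r₂ s) hc.2
      ((D₁.cr.mono (D₁.sub hc0 (by linarith))).sub (D₂.cr.mono (D₂.sub hc0 (by linarith))))
      (fun s hs => (D₁.dr s (m1 s hs)).sub (D₂.dr s (m2 s hs)))
      (fun s hs => by
        have := one_div_lt_one_div_of_lt (D₁.ppos s (m1 s hs)) (hlt s ⟨hs.1, hs.2.le⟩)
        rw [neg_div, neg_div]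
        linarith)
    linarith
  · have := ends_ge (g := fun s => r₂ s * Real.sqrt (p₂ s ^ 2 + 2 * F s) -
        r₁ s * Real.sqrt (p₁ s ^ 2 + 2 * F s)) hc.2.le
      ((cW H D₂ hc0 (by linarith)).sub (cW H D₁ hc0 (by linarith)))
      (fun s hs => (dW H D₂ (m2 s hs)).sub (dW H D₁ (m1 s hs)))
      (fun s hs => by
        have e1 := D₁.Epos s ⟨(m1 s hs).1, (m1 s hs).2.le⟩
        have e2 := D₂.Epos s ⟨(m2 s hs).1, (m2 s hs).2.le⟩
        have := W_ineq (k := (N:ℝ) - 1) (by linarith) (D₁.ppos s (m1 s hs))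
          (hlt s ⟨hs.1, hs.2.le⟩) (H.Fneg s (m1 s hs).1.le (by linarith [hs.2]))
          (Real.sqrt_pos.2 e1) (Real.sqrt_pos.2 e2) (Real.sq_sqrt e1.le) (Real.sq_sqrt e2.le)
        linarith)
    linarith

lemma final (H : FH N f F g β) (D₁ : Br N f F β (-1) M₁ r₁ p₁)
    (D₂ : Br N f F β (-1) M₂ r₂ p₂) (h0 : r₁ 0 = r₂ 0)
    {s0 : ℝ} (hs0 : s0 ∈ Ioc 0 β) (hr : r₂ s0 ≤ r₁ s0) (hp : p₁ s0 < p₂ s0)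
    (hW : r₁ s0 * Real.sqrt (p₁ s0 ^ 2 + 2 * F s0) < r₂ s0 * Real.sqrt (p₂ s0 ^ 2 + 2 * F s0)) :
    False := by
  have hM₁ := D₁.hM
  have hM₂ := D₂.hM
  have hsβ := hs0.2
  by_cases hall : ∀ x ∈ Icc 0 s0, 0 < p₂ x - p₁ x
  · have := (final_step H D₁ D₂ hs0 hr hW ⟨le_rfl, hs0.1⟩
      (fun s hs => sub_pos.1 (hall s ⟨hs.1.le, hs.2⟩))).1
    linarith
  · obtain ⟨c, hc, h1, h2⟩ := contact_down (g := fun s => p₂ s - p₁ s)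
      ((D₂.cp.mono (D₂.sub le_rfl (by linarith))).sub (D₁.cp.mono (D₁.sub le_rfl (by linarith))))
      (sub_pos.2 hp) hall
    obtain ⟨h3, h4⟩ := final_step H D₁ D₂ hs0 hr hW hc (fun s hs => sub_pos.1 (h2 s hs))
    have h5 : p₂ c = p₁ c := by linarith
    rw [h5] at h4
    have := lt_of_mul_lt_mul_right h4 (Real.sqrt_nonneg _)
    linarith

set_option maxHeartbeats 1000000 in
/-- The final step below `s0 > β`. -/
lemma down (H : FH N f F g β) (D₁ : Br N f F β (-1) M₁ r₁ p₁)
    (D₂ : Br N f F β (-1) M₂ r₂ p₂) (h0 : r₁ 0 = r₂ 0) (hM : M₁ < M₂)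
    {s0 : ℝ} (hs0 : s0 ∈ Ioc β M₁) (hr : r₂ s0 ≤ r₁ s0)
    (hz : r₁ s0 ^ N * p₁ s0 < r₂ s0 ^ N * p₂ s0)
    (hP : -(2 * (-1) * (N + 1)) * (F s0 / f s0) * (r₂ s0 ^ N * p₂ s0)
        - r₂ s0 ^ (N + 1) * (p₂ s0 ^ 2 + 2 * F s0) <
      -(2 * (-1) * (N + 1)) * (F s0 / f s0) * (r₁ s0 ^ N * p₁ s0)
        - r₁ s0 ^ (N + 1) * (p₁ s0 ^ 2 + 2 * F s0))
    (hP0 : ∀ s ∈ Icc β M₂, -(2 * (-1) * (N + 1)) * (F s / f s) * (r₂ s ^ N * p₂ s)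
        - r₂ s ^ (N + 1) * (p₂ s ^ 2 + 2 * F s) ≤ 0) :
    False := by
  have hM₁ := D₁.hM
  have hM₂ := D₂.hM
  have hβ := H.hβ
  have hN : (1:ℝ) ≤ N := by exact_mod_cast H.hN
  have hs0M := hs0.2
  have hs0β := hs0.1
  have rp1 : ∀ s ∈ Icc β s0, 0 < r₁ s := fun s hs => D₁.rpos s ⟨by linarith [hs.1], by linarith [hs.2]⟩
  have rp2 : ∀ s ∈ Icc β s0, 0 < r₂ s := fun s hs => D₂.rpos s ⟨by linarith [hs.1], by linarith [hs.2]⟩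
  have pp2 : ∀ s ∈ Icc β s0, 0 < p₂ s := fun s hs => D₂.ppos s ⟨by linarith [hs.1], by linarith [hs.2]⟩
  have pp1 : ∀ s ∈ Ico β s0, 0 < p₁ s := fun s hs => D₁.ppos s ⟨by linarith [hs.1], by linarith [hs.2]⟩
  have hp : p₁ s0 < p₂ s0 := by
    have a := rp2 s0 ⟨hs0β.le, le_rfl⟩
    have d : r₂ s0 ^ N ≤ r₁ s0 ^ N := pow_le_pow_left₀ a.le hr _
    have p1 := D₁.pnn (s := s0) ⟨by linarith, by linarith⟩
    have h3 : r₂ s0 ^ N * p₁ s0 < r₂ s0 ^ N * p₂ s0 :=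
      lt_of_le_of_lt (mul_le_mul_of_nonneg_right d p1) hz
    exact lt_of_mul_lt_mul_left h3 (by positivity)
  obtain ⟨c, hc, hlt, hcc⟩ : ∃ c ∈ Ico β s0, (∀ s ∈ Ioc c s0, p₁ s < p₂ s) ∧
      (c = β ∨ p₁ c = p₂ c) := by
    by_cases hall : ∀ x ∈ Icc β s0, 0 < p₂ x - p₁ x
    · exact ⟨β, ⟨le_rfl, hs0β⟩, fun s hs => sub_pos.1 (hall s ⟨hs.1.le, hs.2⟩), Or.inl rfl⟩
    · obtain ⟨c, hc, h1, h2⟩ := contact_down (g := fun s => p₂ s - p₁ s)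
        ((D₂.cp.mono (D₂.sub (by linarith) (by linarith))).sub
          (D₁.cp.mono (D₁.sub (by linarith) (by linarith)))) (sub_pos.2 hp) hall
      exact ⟨c, hc, fun s hs => sub_pos.1 (h2 s hs), Or.inr (by linarith)⟩
  have hcβ := hc.1
  have hcs := hc.2
  have m1 : ∀ s ∈ Ioo c s0, s ∈ Ioo 0 M₁ := fun s hs => ⟨by linarith [hs.1], by linarith [hs.2]⟩
  have m2 : ∀ s ∈ Ioo c s0, s ∈ Ioo 0 M₂ := fun s hs => ⟨by linarith [hs.1], by linarith [hs.2]⟩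
  have hrc : r₂ c < r₁ c := by
    have := ends_gt (g := fun s => r₁ s - r₂ s) hc.2
      ((D₁.cr.mono (D₁.sub (by linarith) (by linarith))).sub
        (D₂.cr.mono (D₂.sub (by linarith) (by linarith))))
      (fun s hs => (D₁.dr s (m1 s hs)).sub (D₂.dr s (m2 s hs)))
      (fun s hs => by
        have := one_div_lt_one_div_of_lt (D₁.ppos s (m1 s hs)) (hlt s ⟨hs.1, hs.2.le⟩)
        rw [neg_div, neg_div]
        linarith)
    linarith
  have hcI : c ∈ Icc β s0 := ⟨hcβ, hcs.le⟩
  have r1c := rp1 c hcI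
  have r2c := rp2 c hcI
  have p2c := pp2 c hcI
  have p1c := pp1 c hc
  have hE1 := D₁.Epos c ⟨by linarith, by linarith⟩
  have hE2 := D₂.Epos c ⟨by linarith, by linarith⟩
  -- conclusion from the common inequality
  have fin : (p₁ c = p₂ c → False) → (c = β → r₁ c * p₁ c < r₂ c * p₂ c) → False := by
    intro k1 k2
    rcases hcc with h | h
    · subst h
      have k3 := k2 rfl
      refine final H D₁ D₂ h0 (s0 := c) ⟨by linarith, le_rfl⟩ hrc.le ?_ ?_
      · by_contra hcon
        have : r₂ c * p₂ c ≤ r₁ c * p₁ c := mul_le_mul hrc.le (not_lt.1 hcon) p2c.le r1c.le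
        linarith
      · rw [H.Fβ, mul_zero, add_zero, add_zero, Real.sqrt_sq p1c.le, Real.sqrt_sq p2c.le]
        exact k3
    · exact k1 h
  -- monotonicity of the P difference where z₁ ≤ z₂
  have Pstep : ∀ e ∈ Ico c s0, (∀ s ∈ Ioo e s0, r₁ s ^ N * p₁ s ≤ r₂ s ^ N * p₂ s) →
      2 * (N + 1) * (F e / f e) * (r₂ e ^ N * p₂ e - r₁ e ^ N * p₁ e) <
        r₂ e ^ (N + 1) * (p₂ e ^ 2 + 2 * F e) - r₁ e ^ (N + 1) * (p₁ e ^ 2 + 2 * F e) := by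
    intro e he hle
    have hce := he.1
    have hes := he.2
    have := ends_le (g := fun s => (-(2 * (-1) * (N + 1)) * (F s / f s) * (r₂ s ^ N * p₂ s)
        - r₂ s ^ (N + 1) * (p₂ s ^ 2 + 2 * F s)) -
        (-(2 * (-1) * (N + 1)) * (F s / f s) * (r₁ s ^ N * p₁ s)
        - r₁ s ^ (N + 1) * (p₁ s ^ 2 + 2 * F s))) hes.le
      ((D₂.cP H (by linarith) (by linarith)).sub (D₁.cP H (by linarith) (by linarith)))
      (fun s hs => (D₂.dP H (m2 s ⟨by linarith [hs.1], hs.2⟩) (by linarith [hs.1])).sub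
        (D₁.dP H (m1 s ⟨by linarith [hs.1], hs.2⟩) (by linarith [hs.1])))
      (fun s hs => by
        have a := hle s hs
        have b := H.hg s (by linarith [hs.1])
        nlinarith)
    linarith
  by_cases hall : ∀ x ∈ Icc c s0, 0 < r₂ x ^ N * p₂ x - r₁ x ^ N * p₁ x
  · have h1 := Pstep c ⟨le_rfl, hcs⟩ (fun s hs => (sub_pos.1 (hall s ⟨hs.1.le, hs.2.le⟩)).le)
    have hz := hall c ⟨le_rfl, hcs.le⟩
    have hF : 0 ≤ F c := by
      rcases hcβ.eq_or_lt with h | h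
      · rw [← h, H.Fβ]
      · exact (H.Fpos c h).le
    have hfc := H.fpos c (by linarith)
    have h2 : 0 ≤ 2 * (N + 1) * (F c / f c) * (r₂ c ^ N * p₂ c - r₁ c ^ N * p₁ c) := by positivity
    apply fin
    · intro h
      rw [h] at hz
      have : r₂ c ^ N ≤ r₁ c ^ N := pow_le_pow_left₀ r2c.le hrc.le _
      nlinarith
    · intro h
      rw [h, H.Fβ, ← h] at h1
      simp only [zero_div, mul_zero, zero_mul, add_zero, sub_pos] at h1
      obtain ⟨k, rfl⟩ : ∃ k, N = k + 1 := ⟨N - 1, by have := H.hN; omega⟩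
      refine lt_of_pow_lt_pow_left₀ 2 (by positivity) ?_
      have h3 : r₂ c ^ k ≤ r₁ c ^ k := pow_le_pow_left₀ r2c.le hrc.le _
      have h4 : r₂ c ^ k * (r₂ c * p₂ c) ^ 2 ≤ r₁ c ^ k * (r₂ c * p₂ c) ^ 2 :=
        mul_le_mul_of_nonneg_right h3 (by positivity)
      have h5 : r₁ c ^ k * (r₁ c * p₁ c) ^ 2 < r₁ c ^ k * (r₂ c * p₂ c) ^ 2 := by
        calc _ = r₁ c ^ (k + 1 + 1) * p₁ c ^ 2 := by ring
          _ < r₂ c ^ (k + 1 + 1) * p₂ c ^ 2 := h1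
          _ = r₂ c ^ k * (r₂ c * p₂ c) ^ 2 := by ring
          _ ≤ _ := h4
      exact lt_of_mul_lt_mul_left h5 (by positivity)
  · obtain ⟨e, he, h1, h2⟩ := contact_down (g := fun x => r₂ x ^ N * p₂ x - r₁ x ^ N * p₁ x)
      ((D₂.cz (by linarith) (by linarith)).sub (D₁.cz (by linarith) (by linarith)))
      (sub_pos.2 hz) hall
    have hce := he.1
    have hes := he.2
    have h3 := Pstep e he (fun s hs => (sub_pos.1 (h2 s ⟨hs.1, hs.2.le⟩)).le)
    rw [h1, mul_zero] at h3
    have zp2 : ∀ s ∈ Icc c e, r₂ s ^ N * p₂ s ≠ 0 := fun s hs => by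
      have hI : s ∈ Icc β s0 := ⟨by linarith [hs.1], by linarith [hs.2]⟩
      have := rp2 s hI
      have := pp2 s hI
      positivity
    have hT := ends_ge (g := fun s => (r₁ s ^ N * p₁ s) / (r₂ s ^ N * p₂ s) *
          (r₂ s ^ (N + 1) * (p₂ s ^ 2 + 2 * F s)) - r₁ s ^ (N + 1) * (p₁ s ^ 2 + 2 * F s))
        (g' := fun s => (r₁ s ^ N * p₁ s) / (r₂ s ^ N * p₂ s) * f s *
          (1 / p₁ s ^ 2 - 1 / p₂ s ^ 2) *
          (-(2 * (-1) * (N + 1)) * (F s / f s) * (r₂ s ^ N * p₂ s)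
        - r₂ s ^ (N + 1) * (p₂ s ^ 2 + 2 * F s))) hce
      ((((D₁.cz (by linarith) (by linarith)).div (D₂.cz (by linarith) (by linarith)) zp2).mul
        (D₂.cA H (by linarith) (by linarith))).sub (D₁.cA H (by linarith) (by linarith)))
      (fun s hs => by
        have hI : s ∈ Icc β s0 := ⟨by linarith [hs.1], by linarith [hs.2]⟩
        have hs' : s ∈ Ioo c s0 := ⟨hs.1, by linarith [hs.2]⟩
        have a1 := rp1 s hI
        have a2 := rp2 s hI
        have a3 := pp2 s hI
        have a4 := D₁.ppos s (m1 s hs')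
        have a5 := H.fpos s (by linarith [hs.1])
        refine ((((D₁.dz H (m1 s hs')).div (D₂.dz H (m2 s hs'))
          (zp2 s ⟨hs.1.le, hs.2.le⟩)).mul (D₂.dA H (m2 s hs'))).sub
            (D₁.dA H (m1 s hs'))).congr_deriv ?_
        simp only [Pi.div_apply]
        field_simp
        ring)
      (fun s hs => by
        have hI : s ∈ Icc β s0 := ⟨by linarith [hs.1], by linarith [hs.2]⟩
        have hs' : s ∈ Ioo c s0 := ⟨hs.1, by linarith [hs.2]⟩
        have a1 := rp1 s hI
        have a2 := rp2 s hI
        have a3 := pp2 s hI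
        have a4 := D₁.ppos s (m1 s hs')
        have a5 := H.fpos s (by linarith [hs.1])
        have a6 := hlt s ⟨hs.1, by linarith [hs.2]⟩
        have a7 : 0 ≤ 1 / p₁ s ^ 2 - 1 / p₂ s ^ 2 := by
          rw [sub_nonneg]
          exact one_div_le_one_div_of_le (by positivity) (by gcongr)
        refine mul_nonpos_of_nonneg_of_nonpos (by positivity) ?_
        exact hP0 s ⟨by linarith [hs.1], by linarith [hs.2]⟩)
    have hTe : (r₁ e ^ N * p₁ e) / (r₂ e ^ N * p₂ e) = 1 := by
      rw [sub_eq_zero.1 h1]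
      have := zp2 e ⟨hce, le_rfl⟩
      rw [sub_eq_zero.1 h1] at this
      exact div_self this
    have hTc : 0 < (r₁ c ^ N * p₁ c) / (r₂ c ^ N * p₂ c) *
          (r₂ c ^ (N + 1) * (p₂ c ^ 2 + 2 * F c)) - r₁ c ^ (N + 1) * (p₁ c ^ 2 + 2 * F c) := by
      simp only [hTe, one_mul] at hT
      linarith
    have key : p₂ c * (r₁ c * (p₁ c ^ 2 + 2 * F c)) < p₁ c * (r₂ c * (p₂ c ^ 2 + 2 * F c)) := by
      have e1 : (r₁ c ^ N * p₁ c) / (r₂ c ^ N * p₂ c) *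
          (r₂ c ^ (N + 1) * (p₂ c ^ 2 + 2 * F c)) - r₁ c ^ (N + 1) * (p₁ c ^ 2 + 2 * F c) =
          r₁ c ^ N / p₂ c * (p₁ c * (r₂ c * (p₂ c ^ 2 + 2 * F c)) -
            p₂ c * (r₁ c * (p₁ c ^ 2 + 2 * F c))) := by
        field_simp
        try ring
      rw [e1] at hTc
      have := (mul_pos_iff_of_pos_left (by positivity : 0 < r₁ c ^ N / p₂ c)).1 hTc
      linarith
    apply fin
    · intro h
      rw [h] at key
      have k1 := lt_of_mul_lt_mul_left key p2c.le
      have := lt_of_mul_lt_mul_right k1 hE2.le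
      linarith
    · intro h
      rw [h, H.Fβ, ← h] at key
      have k1 : (p₁ c * p₂ c) * (r₁ c * p₁ c) < (p₁ c * p₂ c) * (r₂ c * p₂ c) := by
        linarith
      exact lt_of_mul_lt_mul_left k1 (by positivity)

end
end AnnU


namespace AnnU

section
variable {N : ℕ} {f F g : ℝ → ℝ} {β M₁ M₂ : ℝ} {r₁ p₁ r₂ p₂ R₁ Q₁ R₂ Q₂ : ℝ → ℝ}

/-- Comparison of the functional `P` at the first maximum. -/
lemma P_at_top (H : FH N f F g β) (I₁ : Br N f F β 1 M₁ r₁ p₁) (I₂ : Br N f F β 1 M₂ r₂ p₂)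
    (D₁ : Br N f F β (-1) M₁ R₁ Q₁) (D₂ : Br N f F β (-1) M₂ R₂ Q₂)
    (h0 : r₁ 0 = r₂ 0) (hp1 : 0 < p₁ 0) (hp : p₁ 0 < p₂ 0)
    (e1 : r₁ M₁ = R₁ M₁) (e2 : r₂ M₂ = R₂ M₂) :
    (∀ s ∈ Icc β M₂, -(2 * (-1) * (N + 1)) * (F s / f s) * (R₂ s ^ N * Q₂ s)
        - R₂ s ^ (N + 1) * (Q₂ s ^ 2 + 2 * F s) ≤ 0) ∧
    -(2 * (-1) * (N + 1)) * (F M₁ / f M₁) * (R₂ M₁ ^ N * Q₂ M₁)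
        - R₂ M₁ ^ (N + 1) * (Q₂ M₁ ^ 2 + 2 * F M₁) <
      -(2 * (-1) * (N + 1)) * (F M₁ / f M₁) * (R₁ M₁ ^ N * Q₁ M₁)
        - R₁ M₁ ^ (N + 1) * (Q₁ M₁ ^ 2 + 2 * F M₁) := by
  obtain ⟨hM, hr, hz⟩ := inc_full H I₁ I₂ h0 hp1 hp
  have hM₁ := I₁.hM
  have hM₂ := I₂.hM
  have hβ := H.hβ
  have hN : (1:ℝ) ≤ N := by exact_mod_cast H.hN
  -- the decreasing branch: P is monotone
  have Dmono : ∀ c ∈ Icc β M₂, -(2 * (-1) * (N + 1)) * (F c / f c) * (R₂ c ^ N * Q₂ c)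
        - R₂ c ^ (N + 1) * (Q₂ c ^ 2 + 2 * F c) ≤
      - R₂ M₂ ^ (N + 1) * (2 * F M₂) := by
    intro c hc
    have := ends_le hc.2 (D₂.cP H (by linarith [hc.1]) le_rfl)
      (fun s hs => D₂.dP H ⟨by linarith [hs.1, hc.1], hs.2⟩ (by linarith [hs.1, hc.1]))
      (fun s hs => by
        have a := H.hg s (by linarith [hs.1, hc.1])
        have b := D₂.ppos s ⟨by linarith [hs.1, hc.1], hs.2⟩
        have d := D₂.rpos s ⟨by linarith [hs.1, hc.1], hs.2.le⟩
        have : 0 ≤ R₂ s ^ N * Q₂ s := by positivity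
        refine mul_nonneg ?_ this
        linarith)
    rw [D₂.pM] at this
    linarith
  have Imono : - R₂ M₂ ^ (N + 1) * (2 * F M₂) ≤
      -(2 * 1 * (N + 1)) * (F M₁ / f M₁) * (r₂ M₁ ^ N * p₂ M₁)
        - r₂ M₁ ^ (N + 1) * (p₂ M₁ ^ 2 + 2 * F M₁) := by
    have := ends_ge hM.le (I₂.cP H (by linarith) le_rfl)
      (fun s hs => I₂.dP H ⟨by linarith [hs.1], hs.2⟩ (by linarith [hs.1]))
      (fun s hs => by
        have a := H.hg s (by linarith [hs.1])
        have b := I₂.ppos s ⟨by linarith [hs.1], hs.2⟩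
        have d := I₂.rpos s ⟨by linarith [hs.1], hs.2.le⟩
        have : 0 ≤ r₂ s ^ N * p₂ s := by positivity
        refine mul_nonpos_of_nonpos_of_nonneg ?_ this
        linarith)
    rw [I₂.pM, e2] at this
    linarith
  refine ⟨fun s hs => ?_, ?_⟩
  · refine (Dmono s hs).trans ?_
    have a := H.Fpos M₂ hM₂
    have b := D₂.rpos M₂ ⟨by linarith, le_rfl⟩
    have : 0 ≤ R₂ M₂ ^ (N + 1) * (2 * F M₂) := by positivity
    linarith
  have h1 := ends_ge (g := fun s => (-(2 * 1 * (N + 1)) * (F s / f s) * (r₂ s ^ N * p₂ s)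
        - r₂ s ^ (N + 1) * (p₂ s ^ 2 + 2 * F s)) -
        (-(2 * 1 * (N + 1)) * (F s / f s) * (r₁ s ^ N * p₁ s)
        - r₁ s ^ (N + 1) * (p₁ s ^ 2 + 2 * F s))) hM₁.le
      ((I₂.cP H (by linarith) (by linarith)).sub (I₁.cP H (by linarith) (by linarith)))
      (fun s hs => (I₂.dP H ⟨by linarith [hs.1], by linarith [hs.2]⟩ (by linarith [hs.1])).sub
        (I₁.dP H ⟨by linarith [hs.1], by linarith [hs.2]⟩ (by linarith [hs.1])))
      (fun s hs => by
        have a := hz s ⟨hs.1.le, hs.2.le⟩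
        have b := H.hg s hs.1.le
        nlinarith)
  simp only [H.Fβ, I₁.pM] at h1
  have h2 : r₁ β ^ (N + 1) * p₁ β ^ 2 < r₂ β ^ (N + 1) * p₂ β ^ 2 := by
    have a := hz β ⟨le_rfl, hM₁.le⟩
    have b := hr β ⟨by linarith, hM₁.le⟩
    have r1 := I₁.rpos β ⟨by linarith, hM₁.le⟩
    have r2 := I₂.rpos β ⟨by linarith, hM₂.le⟩
    have q1 := I₁.ppos β ⟨by linarith, hM₁⟩
    have q2 := I₂.ppos β ⟨by linarith, hM₂⟩
    obtain ⟨k, rfl⟩ : ∃ k, N = k + 1 := ⟨N - 1, by have := H.hN; omega⟩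
    have c1 : (r₁ β ^ (k + 1) * p₁ β) ^ 2 < (r₂ β ^ (k + 1) * p₂ β) ^ 2 :=
      pow_lt_pow_left₀ a (by positivity) two_ne_zero
    have c2 : r₂ β ^ k ≤ r₁ β ^ k := pow_le_pow_left₀ r2.le b.le _
    have c3 : r₂ β ^ k * (r₁ β ^ (k + 1 + 1) * p₁ β ^ 2) <
        r₂ β ^ k * (r₂ β ^ (k + 1 + 1) * p₂ β ^ 2) := by
      calc _ ≤ r₁ β ^ k * (r₁ β ^ (k + 1 + 1) * p₁ β ^ 2) :=
            mul_le_mul_of_nonneg_right c2 (by positivity)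
        _ = (r₁ β ^ (k + 1) * p₁ β) ^ 2 := by ring
        _ < (r₂ β ^ (k + 1) * p₂ β) ^ 2 := c1
        _ = _ := by ring
    exact lt_of_mul_lt_mul_left c3 (by positivity)
  have h3 := Dmono M₁ ⟨hM₁.le, hM.le⟩
  rw [D₁.pM, ← e1]
  simp only [zero_div, mul_zero, zero_mul, add_zero, zero_sub, ne_eq, OfNat.ofNat_ne_zero,
    not_false_eq_true, zero_pow, zero_add] at h1 ⊢
  linarith

lemma mid (H : FH N f F g β) (I₁ : Br N f F β 1 M₁ r₁ p₁) (I₂ : Br N f F β 1 M₂ r₂ p₂)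
    (D₁ : Br N f F β (-1) M₁ R₁ Q₁) (D₂ : Br N f F β (-1) M₂ R₂ Q₂)
    (h0 : r₁ 0 = r₂ 0) (hp1 : 0 < p₁ 0) (hp : p₁ 0 < p₂ 0)
    (e1 : r₁ M₁ = R₁ M₁) (e2 : r₂ M₂ = R₂ M₂) (hD0 : R₁ 0 = R₂ 0)
    {s0 : ℝ} (hs0 : s0 ∈ Icc 1 M₁) (hle : R₂ s0 ≤ R₁ s0)
    (hge : ∀ s ∈ Ioo s0 M₁, R₁ s ≤ R₂ s) (heq : s0 < M₁ → R₂ s0 = R₁ s0) : False := by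
  obtain ⟨hM, -, -⟩ := inc_full H I₁ I₂ h0 hp1 hp
  obtain ⟨hP0, hPt⟩ := P_at_top H I₁ I₂ D₁ D₂ h0 hp1 hp e1 e2
  have hM₁ := I₁.hM
  have hM₂ := I₂.hM
  have hβ := H.hβ
  have hs1 := hs0.1
  have hN : (1:ℝ) ≤ N := by exact_mod_cast H.hN
  have hz : ∀ e ∈ Icc s0 M₁, R₁ e ^ N * Q₁ e < R₂ e ^ N * Q₂ e := by
    intro e he
    have hse := he.1
    have heM := he.2
    have := ends_ge (g := fun s => (R₂ s ^ N * Q₂ s) ^ 2 - (R₁ s ^ N * Q₁ s) ^ 2) he.2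
      (((D₂.cz (by linarith) (by linarith)).pow 2).sub
        ((D₁.cz (by linarith) (by linarith)).pow 2))
      (fun s hs => (D₂.dz2 H ⟨by linarith [hs.1], by linarith [hs.2]⟩).sub
        (D₁.dz2 H ⟨by linarith [hs.1], by linarith [hs.2]⟩))
      (fun s hs => by
        have a := hge s ⟨by linarith [hs.1], hs.2⟩
        have b := H.fpos s (by linarith [hs.1])
        have c := D₁.rpos s ⟨by linarith [hs.1], by linarith [hs.2]⟩
        have d : (R₁ s ^ N) ^ 2 ≤ (R₂ s ^ N) ^ 2 := by
          apply pow_le_pow_left₀ (by positivity)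
          exact pow_le_pow_left₀ c.le a _
        nlinarith)
    have a2 := D₂.ppos M₁ ⟨by linarith, hM⟩
    have b2 := D₂.rpos M₁ ⟨by linarith, hM.le⟩
    have a3 := D₂.pnn (s := e) ⟨by linarith, by linarith⟩
    have b3 := D₂.rpos e ⟨by linarith, by linarith⟩
    have c2 : 0 < (R₂ M₁ ^ N * Q₂ M₁) ^ 2 := by positivity
    rw [D₁.pM] at this
    refine lt_of_pow_lt_pow_left₀ 2 (by positivity) ?_
    simp only [mul_zero, ne_eq, OfNat.ofNat_ne_zero, not_false_eq_true, zero_pow, sub_zero] at this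
    linarith
  have hzs := hz s0 ⟨le_rfl, hs0.2⟩
  rcases le_or_gt s0 β with hc | hc
  · have hsM : s0 < M₁ := lt_of_le_of_lt hc hM₁
    have hr := heq hsM
    have hrp := D₁.rpos s0 ⟨by linarith, hsM.le⟩
    rw [hr] at hzs
    have hQ : Q₁ s0 < Q₂ s0 := lt_of_mul_lt_mul_left hzs (by positivity)
    refine final H D₁ D₂ hD0 (s0 := s0) ⟨by linarith, hc⟩ hle hQ ?_
    rw [hr]
    refine mul_lt_mul_of_pos_left ?_ hrp
    have hE := D₁.Epos s0 ⟨by linarith, hsM.le⟩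
    apply Real.sqrt_lt_sqrt hE.le
    have := D₁.ppos s0 ⟨by linarith, hsM⟩
    nlinarith
  · refine down H D₁ D₂ hD0 hM (s0 := s0) ⟨hc, hs0.2⟩ hle hzs ?_ hP0
    have := ends_le (g := fun s => (-(2 * (-1) * (N + 1)) * (F s / f s) * (R₂ s ^ N * Q₂ s)
        - R₂ s ^ (N + 1) * (Q₂ s ^ 2 + 2 * F s)) -
        (-(2 * (-1) * (N + 1)) * (F s / f s) * (R₁ s ^ N * Q₁ s)
        - R₁ s ^ (N + 1) * (Q₁ s ^ 2 + 2 * F s))) hs0.2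
      ((D₂.cP H (by linarith) (by linarith)).sub (D₁.cP H (by linarith) (by linarith)))
      (fun s hs => (D₂.dP H ⟨by linarith [hs.1], by linarith [hs.2]⟩ (by linarith [hs.1])).sub
        (D₁.dP H ⟨by linarith [hs.1], by linarith [hs.2]⟩ (by linarith [hs.1])))
      (fun s hs => by
        have a := hz s ⟨hs.1.le, hs.2.le⟩
        have b := H.hg s (by linarith [hs.1])
        nlinarith)
    linarith

end
end AnnU


namespace AnnU

/-- A positive solution on the annulus. -/
structure Sol (N : ℕ) (a b : ℝ) (f u u' : ℝ → ℝ) : Prop where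
  ha : 0 < a
  hab : a < b
  cu : ContinuousOn u (Icc a b)
  cu' : ContinuousOn u' (Icc a b)
  du : ∀ r ∈ Ioo a b, HasDerivAt u (u' r) r
  ddu : ∀ r ∈ Ioo a b, HasDerivAt u' (-(N / r * u' r + f (u r))) r
  ua : u a = 0
  ub : u b = 0
  upos : ∀ r ∈ Ioo a b, 0 < u r

section
variable {N : ℕ} {f F g : ℝ → ℝ} {β a b : ℝ} {u u' : ℝ → ℝ}

lemma Sol.unn (S : Sol N a b f u u') {r : ℝ} (hr : r ∈ Icc a b) : 0 ≤ u r := by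
  rcases hr.1.eq_or_lt with h | h
  · rw [← h, S.ua]
  rcases hr.2.eq_or_lt with h' | h'
  · rw [h', S.ub]
  · exact (S.upos r ⟨h, h'⟩).le

lemma Sol.dE (H : FH N f F g β) (S : Sol N a b f u u') {r : ℝ} (hr : r ∈ Ioo a b) :
    HasDerivAt (fun r => u' r ^ 2 + 2 * F (u r)) (-(2 * N / r * u' r ^ 2)) r := by
  refine (((S.ddu r hr).pow 2).add
    (((H.dF (u r) (S.upos r hr)).comp r (S.du r hr)).const_mul 2)).congr_deriv ?_
  have : r ≠ 0 := by linarith [hr.1, S.ha]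
  simp only [Nat.cast_ofNat]
  field_simp
  ring

lemma Sol.cE (H : FH N f F g β) (S : Sol N a b f u u') :
    ContinuousOn (fun r => u' r ^ 2 + 2 * F (u r)) (Icc a b) :=
  (S.cu'.pow 2).add (continuousOn_const.mul (H.cF.comp S.cu (fun _ hx => S.unn hx)))

lemma Sol.Emono (H : FH N f F g β) (S : Sol N a b f u u') {x y : ℝ} (hx : a ≤ x) (hxy : x ≤ y)
    (hy : y ≤ b) : u' y ^ 2 + 2 * F (u y) ≤ u' x ^ 2 + 2 * F (u x) :=
  ends_ge hxy ((S.cE H).mono (Icc_subset_Icc hx hy))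
    (fun r hr => S.dE H ⟨lt_of_le_of_lt hx hr.1, lt_of_lt_of_le hr.2 hy⟩)
    (fun r hr => by
      have : 0 < r := by linarith [hr.1, S.ha]
      have : 0 ≤ 2 * N / r * u' r ^ 2 := by positivity
      linarith)

lemma Sol.Epos (H : FH N f F g β) (S : Sol N a b f u u') {r : ℝ} (hr : r ∈ Ico a b) :
    0 < u' r ^ 2 + 2 * F (u r) := by
  by_contra hcon
  have hb : 0 ≤ u' b ^ 2 + 2 * F (u b) := by rw [S.ub, H.F0]; positivity
  have hN : (1:ℝ) ≤ N := by exact_mod_cast H.hN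
  have hra := hr.1
  have hz : ∀ x ∈ Icc r b, u' x ^ 2 + 2 * F (u x) = 0 := fun x hx => by
    have h1 := S.Emono H hr.1 hx.1 hx.2
    have h2 := S.Emono H (hr.1.trans hx.1) hx.2 le_rfl
    linarith
  have hu : ∀ x ∈ Ioo r b, u' x = 0 := fun x hx => by
    have hx' : x ∈ Ioo a b := ⟨lt_of_le_of_lt hr.1 hx.1, hx.2⟩
    have h1 : HasDerivAt (fun r => u' r ^ 2 + 2 * F (u r)) 0 x :=
      (hasDerivAt_const x (0:ℝ)).congr_of_eventuallyEq (by
        filter_upwards [Ioo_mem_nhds hx.1 hx.2] with y hy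
        exact hz y ⟨hy.1.le, hy.2.le⟩)
    have h2 := h1.unique (S.dE H hx')
    have hx0 : 0 < x := by linarith [hx'.1, S.ha]
    have : 0 < 2 * N / x := by positivity
    have h3 : 2 * N / x * u' x ^ 2 = 0 := by linarith
    rcases mul_eq_zero.1 h3 with h | h
    · exact absurd h this.ne'
    · exact pow_eq_zero_iff two_ne_zero |>.1 h
  obtain ⟨x, hx⟩ := exists_between hr.2
  have hx' : x ∈ Ioo a b := ⟨lt_of_le_of_lt hr.1 hx.1, hx.2⟩
  have := ends_ge hx.2.le (S.cu.mono (Icc_subset_Icc hx'.1.le le_rfl))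
    (fun y hy => S.du y ⟨hx'.1.trans hy.1, hy.2⟩) (fun y hy => (hu y ⟨hx.1.trans hy.1, hy.2⟩).le)
  have h3 := ends_le hx.2.le (S.cu.mono (Icc_subset_Icc hx'.1.le le_rfl))
    (fun y hy => S.du y ⟨hx'.1.trans hy.1, hy.2⟩) (fun y hy => (hu y ⟨hx.1.trans hy.1, hy.2⟩).ge)
  rw [S.ub] at h3
  linarith [S.upos x hx']

lemma Sol.crit (H : FH N f F g β) (S : Sol N a b f u u') {c : ℝ} (hc : c ∈ Ioo a b)
    (h : u' c = 0) : β < u c := by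
  by_contra hcon
  have h1 := S.Epos H ⟨hc.1.le, hc.2⟩
  have h2 := H.Fneg (u c) (S.upos c hc).le (not_lt.1 hcon)
  rw [h] at h1
  linarith

lemma Sol.dz (H : FH N f F g β) (S : Sol N a b f u u') {r : ℝ} (hr : r ∈ Ioo a b) :
    HasDerivAt (fun r => r ^ N * u' r) (-(r ^ N * f (u r))) r := by
  refine ((hasDerivAt_pow N r).mul (S.ddu r hr)).congr_deriv ?_
  have : r ≠ 0 := by linarith [hr.1, S.ha]
  obtain ⟨k, rfl⟩ : ∃ k, N = k + 1 := ⟨N - 1, by have := H.hN; omega⟩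
  simp only [Nat.add_sub_cancel]
  field_simp
  ring

lemma Sol.crit_unique (H : FH N f F g β) (S : Sol N a b f u u') {c d : ℝ} (hc : c ∈ Ioo a b)
    (hd : d ∈ Ioo a b) (hcd : c < d) (h1 : u' c = 0) (h2 : u' d = 0) : False := by
  have hsub : Icc c d ⊆ Icc a b := Icc_subset_Icc hc.1.le hd.2.le
  obtain ⟨x, hx, hmin⟩ := isCompact_Icc.exists_isMinOn (nonempty_Icc.2 hcd.le) (S.cu.mono hsub)
  have hxab : x ∈ Ioo a b := ⟨lt_of_lt_of_le hc.1 hx.1, lt_of_le_of_lt hx.2 hd.2⟩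
  have hux : u' x = 0 := by
    rcases hx.1.eq_or_lt with h | h
    · rw [← h, h1]
    rcases hx.2.eq_or_lt with h' | h'
    · rw [h', h2]
    · exact (hmin.isLocalMin (Icc_mem_nhds h h')).hasDerivAt_eq_zero (S.du x hxab)
  have hβx := S.crit H hxab hux
  have hβ := H.hβ
  have := ends_gt (g := fun r => r ^ N * u' r) hcd
    (((continuous_pow N).continuousOn).mul (S.cu'.mono hsub))
    (fun r hr => S.dz H ⟨hc.1.trans hr.1, hr.2.trans hd.2⟩)
    (fun r hr => by
      have a1 : 0 < r := by linarith [hr.1, S.ha, hc.1]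
      have a2 := H.fpos (u r) (by
        have : u x ≤ u r := hmin ⟨hr.1.le, hr.2.le⟩
        linarith)
      have : 0 < r ^ N * f (u r) := by positivity
      linarith)
  rw [h1, h2, mul_zero, mul_zero] at this
  exact lt_irrefl _ this

lemma no_zero_pos {v : ℝ → ℝ} {c d : ℝ} (hv : ContinuousOn v (Icc c d))
    (hz : ∀ x ∈ Icc c d, v x ≠ 0) {t : ℝ} (ht : t ∈ Icc c d) (hvt : 0 < v t) :
    ∀ x ∈ Icc c d, 0 < v x := by
  intro x hx
  by_contra hcon
  have hsub : uIcc x t ⊆ Icc c d := uIcc_subset_Icc hx ht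
  obtain ⟨y, hy, hy0⟩ := intermediate_value_uIcc (hv.mono hsub)
    (show (0:ℝ) ∈ uIcc (v x) (v t) from mem_uIcc_of_le (not_lt.1 hcon) hvt.le)
  exact hz y (hsub hy) hy0

lemma Sol.signs (H : FH N f F g β) (S : Sol N a b f u u') :
    ∃ m ∈ Ioo a b, u' m = 0 ∧ (∀ x ∈ Ico a m, 0 < u' x) ∧ (∀ x ∈ Ioo m b, u' x < 0) ∧
      u' b ≤ 0 := by
  obtain ⟨m, hm, hm0⟩ := exists_hasDerivAt_eq_zero S.hab S.cu (S.ua.trans S.ub.symm) S.du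
  have hmpos := S.upos m hm
  have hl : ∀ x ∈ Ico a m, u' x ≠ 0 := by
    intro x hx h
    rcases hx.1.eq_or_lt with h' | h'
    · have := S.Epos H (r := a) ⟨le_rfl, S.hab⟩
      rw [h', h, ← h', S.ua, H.F0] at this
      norm_num at this
    · exact S.crit_unique H ⟨h', hx.2.trans hm.2⟩ hm hx.2 h hm0
  have hr : ∀ x ∈ Ioo m b, u' x ≠ 0 := fun x hx h =>
    S.crit_unique H hm ⟨hm.1.trans hx.1, hx.2⟩ hx.1 hm0 h
  obtain ⟨t, ht, hts⟩ := exists_hasDerivAt_eq_slope u u' hm.1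
    (S.cu.mono (Icc_subset_Icc_right hm.2.le)) (fun x hx => S.du x ⟨hx.1, hx.2.trans hm.2⟩)
  obtain ⟨t2, ht2, hts2⟩ := exists_hasDerivAt_eq_slope u u' hm.2
    (S.cu.mono (Icc_subset_Icc_left hm.1.le)) (fun x hx => S.du x ⟨hm.1.trans hx.1, hx.2⟩)
  have htp : 0 < u' t := by
    rw [hts, S.ua]; apply div_pos <;> linarith [hm.1]
  have htn : u' t2 < 0 := by
    rw [hts2, S.ub]; apply div_neg_of_neg_of_pos <;> linarith [hm.2]
  have hneg : ∀ x ∈ Ioo m b, u' x < 0 := by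
    intro x hx
    have := no_zero_pos (v := fun x => - u' x) (c := min x t2) (d := max x t2)
      (S.cu'.neg.mono (Icc_subset_Icc (le_min (hm.1.trans hx.1).le (hm.1.trans ht2.1).le)
        (max_le hx.2.le ht2.2.le)))
      (fun y hy h => hr y ⟨lt_of_lt_of_le (lt_min hx.1 ht2.1) hy.1,
        lt_of_le_of_lt hy.2 (max_lt hx.2 ht2.2)⟩ (neg_eq_zero.1 h))
      (t := t2) ⟨min_le_right _ _, le_max_right _ _⟩ (by linarith) x
      ⟨min_le_left _ _, le_max_left _ _⟩
    linarith
  refine ⟨m, hm, hm0, fun x hx => ?_, hneg, ?_⟩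
  · exact no_zero_pos (c := min x t) (d := max x t)
      (S.cu'.mono (Icc_subset_Icc (le_min hx.1 ht.1.le)
        (max_le (hx.2.trans hm.2).le (ht.2.trans hm.2).le)))
      (fun y hy => hl y ⟨(le_min hx.1 ht.1.le).trans hy.1, lt_of_le_of_lt hy.2 (max_lt hx.2 ht.2)⟩)
      (t := t) ⟨min_le_right _ _, le_max_right _ _⟩ htp x ⟨min_le_left _ _, le_max_left _ _⟩
  · by_contra hcon
    rw [not_le] at hcon
    have := no_zero_pos (v := u') (c := t2) (d := b)
      (S.cu'.mono (Icc_subset_Icc (hm.1.trans ht2.1).le le_rfl))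
      (fun y hy => by
        rcases hy.2.eq_or_lt with h | h
        · rw [h]; exact hcon.ne'
        · exact hr y ⟨lt_of_lt_of_le ht2.1 hy.1, h⟩)
      (t := b) ⟨ht2.2.le, le_rfl⟩ hcon t2 ⟨le_rfl, ht2.2.le⟩
    linarith

/-- Extraction of the two monotone branches. -/
lemma Sol.branches (H : FH N f F g β) (S : Sol N a b f u u') :
    ∃ m ∈ Ioo a b, ∃ rI rD : ℝ → ℝ,
      Br N f F β 1 (u m) rI (fun s => u' (rI s)) ∧
      Br N f F β (-1) (u m) rD (fun s => - u' (rD s)) ∧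
      (∀ x ∈ Icc a m, rI (u x) = x) ∧ (∀ x ∈ Icc m b, rD (u x) = x) ∧
      (∀ s ∈ Icc 0 (u m), rI s ∈ Icc a m ∧ u (rI s) = s) ∧
      (∀ s ∈ Icc 0 (u m), rD s ∈ Icc m b ∧ u (rD s) = s) ∧
      (∀ x ∈ Ico a m, 0 < u' x) ∧ (∀ x ∈ Ioo m b, u' x < 0) := by
  obtain ⟨m, hm, hm0, hpos, hneg, hb⟩ := S.signs H
  have hm1 := hm.1
  have hm2 := hm.2
  have ha := S.ha
  have hβ := S.crit H hm hm0
  obtain ⟨rI, i1, i2, i3, i4⟩ := inv_branch (g := u) (g' := u') hm.1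
    (S.cu.mono (Icc_subset_Icc_right hm.2.le)) (fun x hx => S.du x ⟨hx.1, hx.2.trans hm.2⟩)
    (fun x hx => hpos x ⟨hx.1.le, hx.2⟩)
  obtain ⟨ρ, d1, d2, d3, d4⟩ := inv_branch (g := fun x => u (-x)) (g' := fun x => - u' (-x))
    (c := -b) (d := -m) (by linarith)
    (S.cu.comp continuous_neg.continuousOn (fun x hx => ⟨by linarith [hx.2], by linarith [hx.1]⟩))
    (fun x hx => by
      have := (S.du (-x) ⟨by linarith [hx.2], by linarith [hx.1]⟩).comp x (hasDerivAt_neg x)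
      refine this.congr_deriv ?_
      ring)
    (fun x hx => by linarith [hneg (-x) ⟨by linarith [hx.2], by linarith [hx.1]⟩])
  simp only [neg_neg, S.ub] at d1 d2 d3 d4
  rw [S.ua] at i1 i3 i4
  have hum : 0 ≤ u m := (S.upos m hm).le
  have i0 : rI 0 = a := by have := i2 a ⟨le_rfl, hm1.le⟩; rwa [S.ua] at this
  have iM : rI (u m) = m := i2 m ⟨hm1.le, le_rfl⟩
  have d0 : ρ 0 = -b := by
    have := d2 (-b) ⟨le_rfl, by linarith⟩; rwa [neg_neg, S.ub] at this
  have dM : ρ (u m) = -m := by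
    have := d2 (-m) ⟨by linarith, le_rfl⟩; rwa [neg_neg] at this
  refine ⟨m, hm, rI, fun s => - ρ s, ?_, ?_, i2, ?_, i1, ?_, hpos, hneg⟩
  · refine ⟨hβ, i3, ?_, ?_, ?_, ?_, ?_, ?_, ?_, ?_⟩
    · exact S.cu'.comp i3 (fun s hs => ⟨(i1 s hs).1.1, (i1 s hs).1.2.trans hm2.le⟩)
    · intro s hs; exact lt_of_lt_of_le ha (i1 s hs).1.1
    · intro s hs; exact hpos _ ⟨(i4 s hs).1.1.le, (i4 s hs).1.2⟩
    · simp only [i0]; exact (hpos a ⟨le_rfl, hm1⟩).le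
    · simp only [iM, hm0]
    · exact fun s hs => (i4 s hs).2
    · intro s hs
      have hrs := (i4 s hs).1
      have hus := (i1 s ⟨hs.1.le, hs.2.le⟩).2
      have hp := hpos _ ⟨hrs.1.le, hrs.2⟩
      have hr : 0 < rI s := ha.trans hrs.1
      refine ((S.ddu (rI s) ⟨hrs.1, hrs.2.trans hm2⟩).comp s (i4 s hs).2).congr_deriv ?_
      rw [hus]
      field_simp
      ring
    · intro s hs
      have h1 := i1 s ⟨hs.1.le, hs.2⟩
      have := S.Epos H ⟨h1.1.1, lt_of_le_of_lt h1.1.2 hm2⟩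
      rwa [h1.2] at this
  · refine ⟨hβ, d3.neg, ?_, ?_, ?_, ?_, ?_, ?_, ?_, ?_⟩
    · exact (S.cu'.comp d3.neg (fun s hs => by
        have := (d1 s hs).1
        exact ⟨by simp only [Pi.neg_apply]; linarith [this.2], by simp only [Pi.neg_apply]; linarith [this.1]⟩)).neg
    · intro s hs; linarith [(d1 s hs).1.2]
    · intro s hs
      have := (d4 s hs).1
      linarith [hneg (- ρ s) ⟨by linarith [this.2], by linarith [this.1]⟩]
    · simp only [d0, neg_neg]; linarith
    · simp only [dM, neg_neg, hm0, neg_zero]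
    · intro s hs
      refine ((d4 s hs).2.neg).congr_deriv ?_
      rw [neg_div]
    · intro s hs
      have hrs := (d4 s hs).1
      have hus := (d1 s ⟨hs.1.le, hs.2.le⟩).2
      have hmem : - ρ s ∈ Ioo m b := ⟨by linarith [hrs.2], by linarith [hrs.1]⟩
      have hp := hneg _ hmem
      have hr : 0 < - ρ s := by linarith [hmem.1]
      refine ((S.ddu (- ρ s) ⟨hm1.trans hmem.1, hmem.2⟩).comp s (d4 s hs).2.neg).neg.congr_deriv ?_
      rw [hus]
      beta_reduce
      set R := - ρ s
      have hp' := hp.ne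
      have hR' := hr.ne'
      field_simp
      ring
    · intro s hs
      have h1 := d1 s ⟨hs.1.le, hs.2⟩
      have hne : - ρ s ≠ b := by
        intro h
        have h2 := h1.2
        rw [h, S.ub] at h2
        linarith [hs.1]
      have := S.Epos H (r := - ρ s) ⟨by linarith [h1.1.2], lt_of_le_of_ne (by linarith [h1.1.1]) hne⟩
      rw [h1.2] at this
      simpa using this
  · intro x hx
    have := d2 (-x) ⟨by linarith [hx.2], by linarith [hx.1]⟩
    rw [neg_neg] at this
    simp only [this, neg_neg]
  · intro s hs
    have := d1 s hs
    exact ⟨⟨by linarith [this.1.2], by linarith [this.1.1]⟩, this.2⟩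

end
end AnnU


namespace AnnU

section
variable {N : ℕ} {f F g : ℝ → ℝ} {β a b : ℝ} {u₁ u₁' u₂ u₂' : ℝ → ℝ}

lemma slopes_lt (H : FH N f F g β) (S₁ : Sol N a b f u₁ u₁') (S₂ : Sol N a b f u₂ u₂')
    (h : u₁' a < u₂' a) : False := by
  obtain ⟨m₁, hm₁, r₁, R₁, I₁, D₁, i1, d1, i1', d1', pos1, neg1⟩ := S₁.branches H
  obtain ⟨m₂, hm₂, r₂, R₂, I₂, D₂, i2, d2, i2', d2', pos2, neg2⟩ := S₂.branches H
  have hβ := H.hβ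
  have hM1 := I₁.hM
  have a1 : r₁ 0 = a := by
    have := i1 a ⟨le_rfl, hm₁.1.le⟩; rwa [S₁.ua] at this
  have a2 : r₂ 0 = a := by
    have := i2 a ⟨le_rfl, hm₂.1.le⟩; rwa [S₂.ua] at this
  have b1 : R₁ 0 = b := by
    have := d1 b ⟨hm₁.2.le, le_rfl⟩; rwa [S₁.ub] at this
  have b2 : R₂ 0 = b := by
    have := d2 b ⟨hm₂.2.le, le_rfl⟩; rwa [S₂.ub] at this
  have c1 : r₁ (u₁ m₁) = R₁ (u₁ m₁) := by
    rw [i1 m₁ ⟨hm₁.1.le, le_rfl⟩, d1 m₁ ⟨le_rfl, hm₁.2.le⟩]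
  have c2 : r₂ (u₂ m₂) = R₂ (u₂ m₂) := by
    rw [i2 m₂ ⟨hm₂.1.le, le_rfl⟩, d2 m₂ ⟨le_rfl, hm₂.2.le⟩]
  have hp1 : 0 < (fun s => u₁' (r₁ s)) 0 := by
    simp only [a1]; exact pos1 a ⟨le_rfl, hm₁.1⟩
  have hp : (fun s => u₁' (r₁ s)) 0 < (fun s => u₂' (r₂ s)) 0 := by
    simp only [a1, a2]; exact h
  obtain ⟨hM, hr, -⟩ := inc_full H I₁ I₂ (a1.trans a2.symm) hp1 hp
  have key : ∀ s0 ∈ Icc 1 (u₁ m₁), _ := fun s0 hs0 =>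
    mid H I₁ I₂ D₁ D₂ (a1.trans a2.symm) hp1 hp c1 c2 (b1.trans b2.symm) (s0 := s0) hs0
  rcases le_or_gt (R₂ (u₁ m₁)) (R₁ (u₁ m₁)) with hc | hc
  · exact key (u₁ m₁) ⟨by linarith, le_rfl⟩ hc (fun s hs => absurd (hs.1.trans hs.2) (lt_irrefl _))
      (fun h => absurd h (lt_irrefl _))
  by_cases hall : ∀ s ∈ Icc 1 (u₁ m₁), 0 < R₂ s - R₁ s
  swap
  · obtain ⟨e, he, h1, h2⟩ := contact_down (g := fun s => R₂ s - R₁ s)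
      ((D₂.cr.mono (D₂.sub (by linarith) hM.le)).sub (D₁.cr.mono (D₁.sub (by linarith) le_rfl)))
      (sub_pos.2 hc) hall
    exact key e ⟨he.1, he.2.le⟩ (by linarith) (fun s hs => by linarith [h2 s ⟨hs.1, hs.2.le⟩])
      (fun _ => by linarith)
  have hone : (1:ℝ) ∈ Icc 0 (u₁ m₁) := ⟨by norm_num, by linarith⟩
  have mono1 : StrictMonoOn u₁ (Icc a m₁) := strictMono_of
    (S₁.cu.mono (Icc_subset_Icc_right hm₁.2.le)) (fun x hx => S₁.du x ⟨hx.1, hx.2.trans hm₁.2⟩)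
    (fun x hx => pos1 x ⟨hx.1.le, hx.2⟩)
  have mono2 : StrictMonoOn u₂ (Icc a m₂) := strictMono_of
    (S₂.cu.mono (Icc_subset_Icc_right hm₂.2.le)) (fun x hx => S₂.du x ⟨hx.1, hx.2.trans hm₂.2⟩)
    (fun x hx => pos2 x ⟨hx.1.le, hx.2⟩)
  have anti1 : ∀ x y, m₁ ≤ x → x < y → y ≤ b → u₁ y < u₁ x := fun x y hx hxy hy =>
    ends_gt hxy (S₁.cu.mono (Icc_subset_Icc (hm₁.1.le.trans hx) hy))
      (fun t ht => S₁.du t ⟨by linarith [ht.1, hm₁.1], by linarith [ht.2]⟩)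
      (fun t ht => neg1 t ⟨by linarith [ht.1], by linarith [ht.2]⟩)
  have anti2 : ∀ x y, m₂ ≤ x → x < y → y ≤ b → u₂ y < u₂ x := fun x y hx hxy hy =>
    ends_gt hxy (S₂.cu.mono (Icc_subset_Icc (hm₂.1.le.trans hx) hy))
      (fun t ht => S₂.du t ⟨by linarith [ht.1, hm₂.1], by linarith [ht.2]⟩)
      (fun t ht => neg2 t ⟨by linarith [ht.1], by linarith [ht.2]⟩)
  obtain ⟨hc1, hc2⟩ := i1' 1 hone
  obtain ⟨hd1, hd2⟩ := d1' 1 hone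
  set c := r₁ 1 with hcdef
  set d := R₁ 1 with hddef
  have hca : a < c := lt_of_le_of_ne hc1.1 (by
    intro h; rw [← h, S₁.ua] at hc2; norm_num at hc2)
  have hcm : c < m₁ := lt_of_le_of_ne hc1.2 (by
    intro h; rw [h] at hc2; linarith)
  have hdb : d < b := lt_of_le_of_ne hd1.2 (by
    intro h; rw [h, S₁.ub] at hd2; norm_num at hd2)
  have hdm : m₁ < d := lt_of_le_of_ne hd1.1 (by
    intro h; rw [← h] at hd2; linarith)
  have comp : ∀ x ∈ Icc c d, 1 ≤ u₁ x ∧ u₁ x < u₂ x := by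
    intro x hx
    have hx1 := hx.1
    have hx2 := hx.2
    have hs : u₁ x ∈ Icc 1 (u₁ m₁) ∧ r₁ (u₁ x) ≤ x ∧ x ≤ R₁ (u₁ x) := by
      rcases le_total x m₁ with hxm | hxm
      · have t1 : 1 ≤ u₁ x := by
          rw [← hc2]; exact mono1.monotoneOn hc1 ⟨by linarith, hxm⟩ hx1
        have t2 : u₁ x ≤ u₁ m₁ := mono1.monotoneOn ⟨by linarith, hxm⟩ ⟨hm₁.1.le, le_rfl⟩ hxm
        refine ⟨⟨t1, t2⟩, (i1 x ⟨by linarith, hxm⟩).le, ?_⟩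
        exact hxm.trans (d1' (u₁ x) ⟨by linarith, t2⟩).1.1
      · have t1 : 1 ≤ u₁ x := by
          rcases hx2.eq_or_lt with e | e
          · rw [e, hd2]
          · rw [← hd2]; exact (anti1 x d hxm e hdb.le).le
        have t2 : u₁ x ≤ u₁ m₁ := by
          rcases hxm.eq_or_lt with e | e
          · rw [e]
          · exact (anti1 m₁ x le_rfl e (by linarith)).le
        refine ⟨⟨t1, t2⟩, ?_, (d1 x ⟨hxm, by linarith⟩).ge⟩
        exact (i1' (u₁ x) ⟨by linarith, t2⟩).1.2.trans hxm
    obtain ⟨hs1, hs2, hs3⟩ := hs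
    set s := u₁ x with hsdef
    have t1 := hr s ⟨by linarith [hs1.1], hs1.2⟩
    have t2 := hall s hs1
    obtain ⟨t3, t4⟩ := i2' s ⟨by linarith [hs1.1], by linarith [hs1.2]⟩
    obtain ⟨t5, t6⟩ := d2' s ⟨by linarith [hs1.1], by linarith [hs1.2]⟩
    refine ⟨hs1.1, ?_⟩
    rcases le_total x m₂ with hxm | hxm
    · have := mono2 t3 (⟨by linarith [t3.1], hxm⟩ : x ∈ Icc a m₂) (by linarith : r₂ s < x)
      linarith
    · have := anti2 x (R₂ s) hxm (by linarith) t5.2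
      linarith
  have hcd : c < d := hcm.trans hdm
  have hsub : Icc c d ⊆ Icc a b := Icc_subset_Icc hca.le hdb.le
  have W := ends_le (g := fun x => (x ^ N * u₁' x) * (u₂ x - 1) - (x ^ N * u₂' x) * (u₁ x - 1))
    (g' := fun x => x ^ N * (f (u₂ x) * (u₁ x - 1) - f (u₁ x) * (u₂ x - 1))) hcd.le
    (((((continuous_pow N).continuousOn).mul (S₁.cu'.mono hsub)).mul
      ((S₂.cu.mono hsub).sub continuousOn_const)).sub
      ((((continuous_pow N).continuousOn).mul (S₂.cu'.mono hsub)).mul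
      ((S₁.cu.mono hsub).sub continuousOn_const)))
    (fun x hx => by
      have hx' : x ∈ Ioo a b := ⟨hca.trans hx.1, hx.2.trans hdb⟩
      refine (((S₁.dz H hx').mul ((S₂.du x hx').sub_const 1)).sub
        ((S₂.dz H hx').mul ((S₁.du x hx').sub_const 1))).congr_deriv ?_
      ring)
    (fun x hx => by
      obtain ⟨t1, t2⟩ := comp x ⟨hx.1.le, hx.2.le⟩
      have hx0 : 0 < x := by linarith [S₁.ha, hx.1]
      have := H.f4 (u₁ x) (u₂ x) t1 t2.le
      refine mul_nonneg (by positivity) ?_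
      linarith)
  have hc3 := (comp c ⟨le_rfl, hcd.le⟩).2
  have hd3 := (comp d ⟨hcd.le, le_rfl⟩).2
  simp only [hc2, hd2, sub_self, mul_zero, sub_zero] at W
  have hc0 : 0 < c := S₁.ha.trans hca
  have hd0 : 0 < d := hc0.trans hcd
  have w1 : 0 < (c ^ N * u₁' c) * (u₂ c - 1) := by
    have := pos1 c ⟨hca.le, hcm⟩
    have : 0 < u₂ c - 1 := by linarith
    positivity
  have w2 : (d ^ N * u₁' d) * (u₂ d - 1) ≤ 0 := by
    have := neg1 d ⟨hdm, hdb⟩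
    refine mul_nonpos_of_nonpos_of_nonneg (mul_nonpos_of_nonneg_of_nonpos (by positivity) this.le)
      (by linarith)
  linarith

lemma gron_alg {D δ α κ n fs A B C : ℝ} (hα0 : 0 ≤ α) (hα : α ≤ A) (hκ0 : 0 ≤ κ) (hκ : κ ≤ B)
    (hn : 0 ≤ n) (hf : fs ≤ C) (hC : 0 ≤ C) :
    2 * D * (-(δ * α)) + 2 * δ * (n * D * κ + fs * δ * α) ≤
      (A + n * B + 2 * C * A) * (D ^ 2 + δ ^ 2) := by
  have h1 : α * (-(2 * D * δ)) ≤ α * (D ^ 2 + δ ^ 2) :=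
    mul_le_mul_of_nonneg_left (by nlinarith [sq_nonneg (D + δ)]) hα0
  have h2 : α * (D ^ 2 + δ ^ 2) ≤ A * (D ^ 2 + δ ^ 2) := mul_le_mul_of_nonneg_right hα (by positivity)
  have h3 : n * κ * (2 * D * δ) ≤ n * κ * (D ^ 2 + δ ^ 2) :=
    mul_le_mul_of_nonneg_left (by nlinarith [sq_nonneg (D - δ)]) (by positivity)
  have h4 : n * κ * (D ^ 2 + δ ^ 2) ≤ n * B * (D ^ 2 + δ ^ 2) :=
    mul_le_mul_of_nonneg_right (mul_le_mul_of_nonneg_left hκ hn) (by positivity)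
  have h5 : fs * α * δ ^ 2 ≤ C * A * (D ^ 2 + δ ^ 2) := by
    calc fs * α * δ ^ 2 ≤ C * α * δ ^ 2 := by gcongr
      _ ≤ C * A * δ ^ 2 := by gcongr
      _ ≤ _ := by
        have hA : 0 ≤ A := hα0.trans hα
        have : 0 ≤ C * A * D ^ 2 := by positivity
        nlinarith
  nlinarith

lemma eq_start (H : FH N f F g β) (S₁ : Sol N a b f u₁ u₁') (S₂ : Sol N a b f u₂ u₂')
    (h : u₁' a = u₂' a) : ∃ t ∈ Ioo a b, (∀ x ∈ Icc a t, u₁ x = u₂ x) ∧ u₁' t = u₂' t := by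
  obtain ⟨m₁, hm₁, r₁, R₁, I₁, -, i1, -, i1', -, pos1, -⟩ := S₁.branches H
  obtain ⟨m₂, hm₂, r₂, R₂, I₂, -, i2, -, i2', -, pos2, -⟩ := S₂.branches H
  have hβ := H.hβ
  have hM1 := I₁.hM
  have hM2 := I₂.hM
  have ha := S₁.ha
  have a1 : r₁ 0 = a := by
    have := i1 a ⟨le_rfl, hm₁.1.le⟩; rwa [S₁.ua] at this
  have a2 : r₂ 0 = a := by
    have := i2 a ⟨le_rfl, hm₂.1.le⟩; rwa [S₂.ua] at this
  have lower : ∀ {M : ℝ} {r p : ℝ → ℝ}, Br N f F β 1 M r p → 0 < p 0 →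
      ∃ c > 0, ∀ s ∈ Icc 0 β, c ≤ p s := by
    intro M r p B hp
    have := B.hM
    obtain ⟨x, hx, hmin⟩ := isCompact_Icc.exists_isMinOn (nonempty_Icc.2 (by linarith : (0:ℝ) ≤ β))
      (B.cp.mono (B.sub le_rfl B.hM.le))
    refine ⟨p x, ?_, fun s hs => hmin hs⟩
    rcases hx.1.eq_or_lt with e | e
    · rw [← e]; exact hp
    · exact B.ppos x ⟨e, by linarith [hx.2]⟩
  obtain ⟨k₁, hk1, hk1'⟩ := lower I₁ (by simp only [a1]; exact pos1 a ⟨le_rfl, hm₁.1⟩)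
  obtain ⟨k₂, hk2, hk2'⟩ := lower I₂ (by simp only [a2]; exact pos2 a ⟨le_rfl, hm₂.1⟩)
  obtain ⟨C, hC⟩ := isCompact_Icc.exists_bound_of_continuousOn
    (H.cf.mono (fun x (hx : x ∈ Icc 0 β) => hx.1))
  have hC0 : 0 ≤ C := (norm_nonneg _).trans (hC 0 ⟨le_rfl, by linarith⟩)
  have sub1 : Icc 0 β ⊆ Icc 0 (u₁ m₁) := Icc_subset_Icc le_rfl hM1.le
  have sub2 : Icc 0 β ⊆ Icc 0 (u₂ m₂) := Icc_subset_Icc le_rfl hM2.le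
  have G := gron (c := 0) (d := β)
    (Φ := fun s => (r₁ s - r₂ s) ^ 2 + (u₁' (r₁ s) - u₂' (r₂ s)) ^ 2)
    (Φ' := fun s => 2 * (r₁ s - r₂ s) * (1 / u₁' (r₁ s) - 1 / u₂' (r₂ s)) +
      2 * (u₁' (r₁ s) - u₂' (r₂ s)) * ((-(1 * N / r₁ s) - f s / u₁' (r₁ s)) -
        (-(1 * N / r₂ s) - f s / u₂' (r₂ s))))
    (K := 1 / (k₁ * k₂) + N * (1 / (a * a)) + 2 * C * (1 / (k₁ * k₂)))
    ((((I₁.cr.mono sub1).sub (I₂.cr.mono sub2)).pow 2).add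
      (((I₁.cp.mono sub1).sub (I₂.cp.mono sub2)).pow 2))
    (fun s hs => by
      have m1 : s ∈ Ioo 0 (u₁ m₁) := ⟨hs.1, hs.2.trans hM1⟩
      have m2 : s ∈ Ioo 0 (u₂ m₂) := ⟨hs.1, hs.2.trans hM2⟩
      refine ((((I₁.dr s m1).sub (I₂.dr s m2)).pow 2).add
        (((I₁.dp s m1).sub (I₂.dp s m2)).pow 2)).congr_deriv ?_
      simp)
    (fun s hs => by
      have hs' : s ∈ Icc 0 β := ⟨hs.1.le, hs.2.le⟩
      have q1 := hk1' s hs'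
      have q2 := hk2' s hs'
      have w1 := (i1' s (sub1 hs')).1.1
      have w2 := (i2' s (sub2 hs')).1.1
      have hf := (le_abs_self _).trans (hC s hs')
      set p₁ := u₁' (r₁ s)
      set p₂ := u₂' (r₂ s)
      have p1 : 0 < p₁ := by linarith
      have p2 : 0 < p₂ := by linarith
      have x1 : 0 < r₁ s := by linarith
      have x2 : 0 < r₂ s := by linarith
      have := gron_alg (D := r₁ s - r₂ s) (δ := p₁ - p₂) (α := 1 / (p₁ * p₂))
        (κ := 1 / (r₁ s * r₂ s)) (n := N) (fs := f s) (A := 1 / (k₁ * k₂)) (B := 1 / (a * a))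
        (C := C) (by positivity)
        (one_div_le_one_div_of_le (by positivity) (mul_le_mul q1 q2 hk2.le p1.le)) (by positivity)
        (one_div_le_one_div_of_le (by positivity) (mul_le_mul w1 w2 ha.le x1.le)) (by positivity)
        hf hC0
      refine le_trans (le_of_eq ?_) this
      field_simp
      ring)
    (by simp [a1, a2, h])
    (fun s _ => by positivity)
  have both : ∀ s ∈ Icc 0 β, r₁ s = r₂ s ∧ u₁' (r₁ s) = u₂' (r₂ s) := by
    intro s hs
    have := G s hs
    beta_reduce at this
    constructor
    · have : (r₁ s - r₂ s) ^ 2 = 0 := by nlinarith [sq_nonneg (r₁ s - r₂ s), sq_nonneg (u₁' (r₁ s) - u₂' (r₂ s))]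
      exact sub_eq_zero.1 (pow_eq_zero_iff two_ne_zero |>.1 this)
    · have : (u₁' (r₁ s) - u₂' (r₂ s)) ^ 2 = 0 := by nlinarith [sq_nonneg (r₁ s - r₂ s), sq_nonneg (u₁' (r₁ s) - u₂' (r₂ s))]
      exact sub_eq_zero.1 (pow_eq_zero_iff two_ne_zero |>.1 this)
  have hβI : β ∈ Icc 0 β := ⟨by linarith, le_rfl⟩
  obtain ⟨e1, e2⟩ := i1' β (sub1 hβI)
  have mono1 : StrictMonoOn u₁ (Icc a m₁) := strictMono_of
    (S₁.cu.mono (Icc_subset_Icc_right hm₁.2.le)) (fun x hx => S₁.du x ⟨hx.1, hx.2.trans hm₁.2⟩)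
    (fun x hx => pos1 x ⟨hx.1.le, hx.2⟩)
  refine ⟨r₁ β, ⟨lt_of_le_of_ne e1.1 ?_, lt_of_le_of_lt e1.2 hm₁.2⟩, ?_, ?_⟩
  · intro h'
    rw [← h', S₁.ua] at e2
    linarith
  · intro x hx
    have hxI : x ∈ Icc a m₁ := ⟨hx.1, hx.2.trans e1.2⟩
    have hu : u₁ x ∈ Icc 0 β := ⟨S₁.unn ⟨hx.1, by linarith [hxI.2, hm₁.2]⟩, by
      rw [← e2]; exact mono1.monotoneOn hxI e1 hx.2⟩
    have h1 := (both _ hu).1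
    rw [i1 x hxI] at h1
    have h2 := (i2' _ (sub2 hu)).2
    rw [← h1] at h2
    exact h2.symm
  · have := both β hβI
    rw [this.2, this.1]

lemma eq_all (H : FH N f F g β) (S₁ : Sol N a b f u₁ u₁') (S₂ : Sol N a b f u₂ u₂')
    (h : u₁' a = u₂' a) : ∀ x ∈ Icc a b, u₁ x = u₂ x := by
  obtain ⟨t, ht, h1, h2⟩ := eq_start H S₁ S₂ h
  intro x hx
  rcases hx.2.eq_or_lt with hb | hb
  · rw [hb, S₁.ub, S₂.ub]
  rcases le_total x t with hxt | hxt
  · exact h1 x ⟨hx.1, hxt⟩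
  have hsub : Icc t x ⊆ Icc a b := Icc_subset_Icc ht.1.le hb.le
  have hsub' : Icc t x ⊆ Ioo a b := fun y hy => ⟨by linarith [hy.1, ht.1], by linarith [hy.2]⟩
  have rng : ∀ {u u' : ℝ → ℝ}, Sol N a b f u u' → ∃ c > 0, ∃ d, ∀ y ∈ Icc t x, u y ∈ Icc c d := by
    intro u u' S
    obtain ⟨y, hy, hmin⟩ := isCompact_Icc.exists_isMinOn (nonempty_Icc.2 hxt) (S.cu.mono hsub)
    obtain ⟨z, hz, hmax⟩ := isCompact_Icc.exists_isMaxOn (nonempty_Icc.2 hxt) (S.cu.mono hsub)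
    exact ⟨u y, S.upos y (hsub' hy), u z, fun w hw => ⟨hmin hw, hmax hw⟩⟩
  obtain ⟨c₁, hc1, d₁, g1⟩ := rng S₁
  obtain ⟨c₂, hc2, d₂, g2⟩ := rng S₂
  obtain ⟨L, hL, hlip⟩ := H.lip (min c₁ c₂) (max d₁ d₂) (lt_min hc1 hc2)
  have G := gron (c := t) (d := x)
    (Φ := fun s => (u₁ s - u₂ s) ^ 2 + (u₁' s - u₂' s) ^ 2)
    (Φ' := fun s => 2 * (u₁ s - u₂ s) * (u₁' s - u₂' s) +
      2 * (u₁' s - u₂' s) * (-(N / s * u₁' s + f (u₁ s)) - -(N / s * u₂' s + f (u₂ s))))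
    (K := 1 + L)
    ((((S₁.cu.mono hsub).sub (S₂.cu.mono hsub)).pow 2).add
      (((S₁.cu'.mono hsub).sub (S₂.cu'.mono hsub)).pow 2))
    (fun s hs => by
      have m := hsub' ⟨hs.1.le, hs.2.le⟩
      refine ((((S₁.du s m).sub (S₂.du s m)).pow 2).add
        (((S₁.ddu s m).sub (S₂.ddu s m)).pow 2)).congr_deriv ?_
      simp)
    (fun s hs => by
      have m : s ∈ Icc t x := ⟨hs.1.le, hs.2.le⟩
      have hs0 : 0 < s := by linarith [hs.1, ht.1, S₁.ha]
      have l := hlip (u₁ s) ⟨(min_le_left _ _).trans (g1 s m).1, (g1 s m).2.trans (le_max_left _ _)⟩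
        (u₂ s) ⟨(min_le_right _ _).trans (g2 s m).1, (g2 s m).2.trans (le_max_right _ _)⟩
      set D := u₁ s - u₂ s
      set δ := u₁' s - u₂' s with hδ
      have q1 : 0 ≤ N / s * δ ^ 2 := by positivity
      have q2 : -(2 * δ * (f (u₁ s) - f (u₂ s))) ≤ L * (D ^ 2 + δ ^ 2) := by
        calc -(2 * δ * (f (u₁ s) - f (u₂ s))) ≤ |2 * δ * (f (u₁ s) - f (u₂ s))| := neg_le_abs _
          _ = 2 * |δ| * |f (u₁ s) - f (u₂ s)| := by rw [abs_mul, abs_mul, abs_two]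
          _ ≤ 2 * |δ| * (L * |D|) := by gcongr
          _ = L * (2 * |D| * |δ|) := by ring
          _ ≤ L * (D ^ 2 + δ ^ 2) := by
            apply mul_le_mul_of_nonneg_left _ hL
            rw [← sq_abs D, ← sq_abs δ]
            exact two_mul_le_add_sq _ _
      have q3 := two_mul_le_add_sq D δ
      have e : 2 * δ * (-(N / s * u₁' s + f (u₁ s)) - -(N / s * u₂' s + f (u₂ s))) =
        -(2 * (N / s * δ ^ 2)) + -(2 * δ * (f (u₁ s) - f (u₂ s))) := by rw [hδ]; ring
      rw [e]
      linarith)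
    (by simp [h1 t ⟨ht.1.le, le_rfl⟩, h2])
    (fun s _ => by positivity) x ⟨hxt, le_rfl⟩
  have : (u₁ x - u₂ x) ^ 2 = 0 := by
    nlinarith [sq_nonneg (u₁ x - u₂ x), sq_nonneg (u₁' x - u₂' x)]
  exact sub_eq_zero.1 (pow_eq_zero_iff two_ne_zero |>.1 this)

end
end AnnU

/-- Corollary 2 (annulus part): for `f(s) = s^p - s^q` with `p > q > 0` and `p > 1`,
under any of the conditions (i)–(iii), problem (R) has at most one positive solution
for every `0 < a < b < ∞`. -/
theorem uniqueness_annulus_diff_powers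
    (n : ℕ) (hn : 2 ≤ n) (p q : ℝ) (hq : 0 < q) (hqp : q < p) (hp : 1 < p)
    (hcond :
      (2 < n ∧ q ≤ 4 / ((n : ℝ) - 2) ∧ p ≤ ((n : ℝ) + 2) / ((n : ℝ) - 2)) ∨
      (2 < n ∧ 4 / ((n : ℝ) - 2) < q ∧
        q < (4 + Real.sqrt (2 * (n : ℝ) * ((n : ℝ) + 2))) / (2 * ((n : ℝ) - 2)) ∧
        p ≤ (2 * (q + 1) +
          Real.sqrt (((n : ℝ) + 2) * (q + 1) * ((n : ℝ) + 2 - ((n : ℝ) - 2) * q))) / (n : ℝ)) ∨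
      (n = 2))
    (a b : ℝ) (ha : 0 < a) (hab : a < b)
    (u₁ u₁' u₂ u₂' : ℝ → ℝ)
    (h₁ : IsPosSolAnn n a b (fun s => s ^ p - s ^ q) u₁ u₁')
    (h₂ : IsPosSolAnn n a b (fun s => s ^ p - s ^ q) u₂ u₂') :
    ∀ r ∈ Icc a b, u₁ r = u₂ r := by
  obtain ⟨N, rfl⟩ : ∃ N, n = N + 1 := ⟨n - 1, by omega⟩
  have hN : 1 ≤ N := by omega
  obtain ⟨F, g, β, H⟩ := AnnU.fh_powers N hN p q hq hqp hp (by
    push_cast at hcond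
    rcases hcond with ⟨h, h'⟩ | ⟨h, h'⟩ | h
    · exact Or.inl ⟨by exact_mod_cast h, h'⟩
    · exact Or.inr (Or.inl ⟨by exact_mod_cast h, h'⟩)
    · exact Or.inr (Or.inr (by
        have h1 : N = 1 := by omega
        rw [h1]; norm_num)))
  have conv : ∀ {u u' : ℝ → ℝ}, IsPosSolAnn (N + 1) a b (fun s => s ^ p - s ^ q) u u' →
      AnnU.Sol N a b (fun s => s ^ p - s ^ q) u u' := by
    rintro u u' ⟨c1, -, c2, c3, c4, c5, c6, c7⟩
    refine ⟨ha, hab, c1, c2, c3, fun r hr => (c4 r hr).congr_deriv ?_, c5, c6, c7⟩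
    push_cast
    ring
  have S₁ := conv h₁
  have S₂ := conv h₂
  rcases lt_trichotomy (u₁' a) (u₂' a) with h | h | h
  · exact (AnnU.slopes_lt H S₁ S₂ h).elim
  · exact AnnU.eq_all H S₁ S₂ h
  · exact (AnnU.slopes_lt H S₂ S₁ h).elim
end

section
/- Assume f satisfies (f1), (f2) and (f3), let 0 < a < b < ∞, and let u₁ and u₂ be two positive solutions of (R) with 0 < u₁'(a) < u₂'(a). Then P₁(M₁) > P₂(M₁). -/
open Set Filter MeasureTheory

lemma Fint_hasDeriv {f : ℝ → ℝ} (hf : ContinuousOn f (Ici 0)) {s : ℝ} (hs : 0 < s) :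
    HasDerivAt (Fint f) (f s) s := by
  unfold Fint
  apply intervalIntegral.integral_hasDerivAt_right
  · apply ContinuousOn.intervalIntegrable
    apply hf.mono
    rw [uIcc_of_le hs.le]
    exact Icc_subset_Ici_self
  · exact ContinuousOn.stronglyMeasurableAtFilter isOpen_Ioi
      (hf.mono Ioi_subset_Ici_self) s hs
  · exact hf.continuousAt (Ici_mem_nhds hs)

lemma Fint_cont {f : ℝ → ℝ} (hf : ContinuousOn f (Ici 0)) (M : ℝ) (hM : 0 ≤ M) :
    ContinuousOn (Fint f) (Icc 0 M) := by
  have h := intervalIntegral.continuousOn_primitive_interval (μ := volume) (f := f) (a := 0) (b := M)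
    (by
      rw [uIcc_of_le hM]
      exact (hf.mono Icc_subset_Ici_self).integrableOn_Icc)
  rw [uIcc_of_le hM] at h
  exact h

/-- Data of the increasing branch, in the variable `s`. -/
structure Br (k : ℕ) (f : ℝ → ℝ) (a M : ℝ) (r v : ℝ → ℝ) : Prop where
  Mpos : 0 < M
  apos : 0 < a
  rcont : ContinuousOn r (Icc 0 M)
  vcont : ContinuousOn v (Icc 0 M)
  rder : ∀ s ∈ Ioo 0 M, HasDerivAt r (v s)⁻¹ s
  vder : ∀ s ∈ Ioo 0 M, HasDerivAt v (-(((k : ℝ) + 1) / r s * v s + f s) * (v s)⁻¹) s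
  vpos : ∀ s ∈ Ico 0 M, 0 < v s
  vM : v M = 0
  r0 : r 0 = a
  rge : ∀ s ∈ Icc 0 M, a ≤ r s
  En : ∀ s ∈ Icc 0 M, 0 ≤ v s ^ 2 + 2 * Fint f s
  FM : 0 < Fint f M

lemma mk_br (k : ℕ) (f : ℝ → ℝ) (hf : ContinuousOn f (Ici 0))
    (a b : ℝ) (ha : 0 < a) (hab : a < b) (u u' : ℝ → ℝ)
    (h : IsPosSolAnn (k + 2) a b f u u') (c : ℝ) (hc : c ∈ Ioo a b)
    (hup : ∀ r ∈ Ico a c, 0 < u' r) (hdown : ∀ r ∈ Ioo c b, u' r < 0)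
    (M : ℝ) (hM : M = u c) (r : ℝ → ℝ)
    (hmem : ∀ s ∈ Icc (0:ℝ) M, r s ∈ Icc a c ∧ u (r s) = s)
    (hinv : ∀ x ∈ Icc a c, r (u x) = x) : Br k f a M r (fun s => u' (r s)) := by
  obtain ⟨hu, -, hu', hd, hdd, hua, hub, hpos⟩ := h
  have hMpos : 0 < M := hM ▸ hpos c hc
  have hnn : ∀ x ∈ Icc a b, 0 ≤ u x := by
    intro x hx
    rcases eq_or_lt_of_le hx.1 with h | h
    · rw [← h, hua]
    rcases eq_or_lt_of_le hx.2 with h' | h'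
    · rw [h', hub]
    exact (hpos x ⟨h, h'⟩).le
  -- continuity of `F ∘ u`
  have hsub : Icc a c ⊆ Icc a b := Icc_subset_Icc_right hc.2.le
  have hmono : StrictMonoOn u (Icc a c) := by
    apply strictMonoOn_of_deriv_pos (convex_Icc a c) (hu.mono hsub)
    intro x hx
    rw [interior_Icc] at hx
    rw [(hd x ⟨hx.1, hx.2.trans hc.2⟩).deriv]
    exact hup x ⟨hx.1.le, hx.2⟩
  have hr0 : r 0 = a := by
    have := hinv a ⟨le_rfl, hc.1.le⟩
    rwa [hua] at this
  have hrM : r M = c := by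
    rw [hM]; exact hinv c ⟨hc.1.le, le_rfl⟩
  have hrmono : StrictMonoOn r (Icc 0 M) := by
    intro s hs t ht hst
    by_contra hcon
    have := hmono.monotoneOn (hmem t ht).1 (hmem s hs).1 (not_lt.1 hcon)
    rw [(hmem t ht).2, (hmem s hs).2] at this
    linarith
  have humaps : ∀ x ∈ Icc a c, u x ∈ Icc 0 M := fun x hx =>
    ⟨hnn x (hsub hx), hM ▸ hmono.monotoneOn hx ⟨hc.1.le, le_rfl⟩ hx.2⟩
  have hrcont : ContinuousOn r (Icc 0 M) := by
    let g : Icc 0 M → Icc a c := fun s => ⟨r s, (hmem s s.2).1⟩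
    have hg : Monotone g := fun s t hst => hrmono.monotoneOn s.2 t.2 hst
    have hgs : Function.Surjective g := fun x =>
      ⟨⟨u x, humaps x x.2⟩, Subtype.ext (hinv x x.2)⟩
    have hgc : Continuous g := hg.continuous_of_surjective hgs
    rw [continuousOn_iff_continuous_domRestrict]
    exact continuous_subtype_val.comp hgc
  have hrIoo : ∀ s ∈ Ioo 0 M, r s ∈ Ioo a c := by
    intro s hs
    constructor
    · rw [← hr0]; exact hrmono ⟨le_rfl, hMpos.le⟩ ⟨hs.1.le, hs.2.le⟩ hs.1
    · rw [← hrM]; exact hrmono ⟨hs.1.le, hs.2.le⟩ ⟨hMpos.le, le_rfl⟩ hs.2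
  have hrIco : ∀ s ∈ Ico 0 M, r s ∈ Ico a c := by
    intro s hs
    constructor
    · exact (hmem s ⟨hs.1, hs.2.le⟩).1.1
    · rw [← hrM]; exact hrmono ⟨hs.1, hs.2.le⟩ ⟨hMpos.le, le_rfl⟩ hs.2
  have hrder : ∀ s ∈ Ioo 0 M, HasDerivAt r (u' (r s))⁻¹ s := by
    intro s hs
    have hrs := hrIoo s hs
    apply HasDerivAt.of_local_left_inverse (f := u)
    · exact hrcont.continuousAt (Icc_mem_nhds hs.1 hs.2)
    · exact hd _ ⟨hrs.1, hrs.2.trans hc.2⟩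
    · exact (hup _ ⟨hrs.1.le, hrs.2⟩).ne'
    · filter_upwards [Icc_mem_nhds hs.1 hs.2] with y hy
      exact (hmem y hy).2
  -- energy
  set E : ℝ → ℝ := fun x => u' x ^ 2 + 2 * Fint f (u x) with hE
  have hMmax : ∀ x ∈ Icc a b, u x ≤ M := by
    intro x hx
    rcases le_total x c with h | h
    · exact (humaps x ⟨hx.1, h⟩).2
    have hanti : AntitoneOn u (Icc c b) := by
      apply antitoneOn_of_deriv_nonpos (convex_Icc c b) (hu.mono (Icc_subset_Icc_left hc.1.le))
      · intro y hy
        rw [interior_Icc] at hy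
        exact (hd y ⟨hc.1.trans hy.1, hy.2⟩).differentiableAt.differentiableWithinAt
      · intro y hy
        rw [interior_Icc] at hy
        rw [(hd y ⟨hc.1.trans hy.1, hy.2⟩).deriv]
        exact (hdown y hy).le
    rw [hM]
    exact hanti ⟨le_rfl, hc.2.le⟩ ⟨h, hx.2⟩ h
  have hEcont : ContinuousOn E (Icc a b) := by
    apply (hu'.pow 2).add
    apply continuousOn_const.mul
    exact (Fint_cont hf M hMpos.le).comp hu (fun x hx => ⟨hnn x hx, hMmax x hx⟩)
  have hEder : ∀ x ∈ Ioo a b, HasDerivAt E (-(2 * ((k : ℝ) + 1) / x * u' x ^ 2)) x := by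
    intro x hx
    have h1 := ((hdd x hx).pow 2).add
      (((Fint_hasDeriv hf (hpos x hx)).comp x (hd x hx)).const_mul 2)
    refine HasDerivAt.congr_deriv h1 ?_
    push_cast
    ring
  have hEanti : AntitoneOn E (Icc a b) := by
    apply antitoneOn_of_deriv_nonpos (convex_Icc a b) hEcont
    · intro y hy
      rw [interior_Icc] at hy
      exact (hEder y hy).differentiableAt.differentiableWithinAt
    · intro y hy
      rw [interior_Icc] at hy
      rw [(hEder y hy).deriv]
      have : 0 < y := ha.trans hy.1
      have : 0 ≤ 2 * ((k : ℝ) + 1) / y * u' y ^ 2 := by positivity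
      linarith
  have hEb : 0 ≤ E b := by
    have : Fint f 0 = 0 := by simp [Fint]
    simp only [hE, hub, this]
    positivity
  have hEs : StrictAntiOn E (Icc c b) := by
    apply strictAntiOn_of_deriv_neg (convex_Icc c b) (hEcont.mono (Icc_subset_Icc_left hc.1.le))
    intro y hy
    rw [interior_Icc] at hy
    rw [(hEder y ⟨hc.1.trans hy.1, hy.2⟩).deriv]
    have : 0 < y := ha.trans (hc.1.trans hy.1)
    have h3 : u' y ≠ 0 := (hdown y hy).ne
    have : 0 < 2 * ((k : ℝ) + 1) / y * u' y ^ 2 := by positivity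
    linarith
  have hEc : 0 < E c := lt_of_le_of_lt hEb (hEs ⟨le_rfl, hc.2.le⟩ ⟨hc.2.le, le_rfl⟩ hc.2)
  have hu'c : u' c = 0 := by
    have hcont : ContinuousAt u' c := hu'.continuousAt (Icc_mem_nhds hc.1 hc.2)
    apply le_antisymm
    · refine le_of_tendsto (hcont.tendsto.mono_left (nhdsWithin_le_nhds (s := Ioi c))) ?_
      filter_upwards [Ioo_mem_nhdsGT hc.2] with y hy
      exact (hdown y hy).le
    · refine ge_of_tendsto (hcont.tendsto.mono_left (nhdsWithin_le_nhds (s := Iio c))) ?_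
      filter_upwards [Ioo_mem_nhdsLT hc.1] with y hy
      exact (hup y ⟨hy.1.le, hy.2⟩).le
  refine ⟨hMpos, ha, hrcont, ?_, hrder, ?_, fun s hs => hup _ (hrIco s hs), ?_, hr0,
    fun s hs => (hmem s hs).1.1, ?_, ?_⟩
  · exact hu'.comp hrcont (fun s hs => hsub (hmem s hs).1)
  · intro s hs
    have hrs := hrIoo s hs
    have h1 := (hdd _ ⟨hrs.1, hrs.2.trans hc.2⟩).comp s (hrder s hs)
    rw [(hmem s ⟨hs.1.le, hs.2.le⟩).2] at h1
    refine HasDerivAt.congr_deriv h1 ?_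
    push_cast
    ring
  · show u' (r M) = 0
    rw [hrM, hu'c]
  · intro s hs
    have h1 := hEanti (hsub (hmem s hs).1) ⟨hab.le, le_rfl⟩ (hsub (hmem s hs).1).2
    simp only [hE] at h1 hEb
    rw [(hmem s hs).2] at h1
    show 0 ≤ u' (r s) ^ 2 + 2 * Fint f s
    linarith
  · simp only [hE, hu'c] at hEc
    rw [← hM] at hEc
    linarith

lemma mono_aux {g g' : ℝ → ℝ} {x y : ℝ} (hxy : x ≤ y) (hc : ContinuousOn g (Icc x y))
    (hd : ∀ s ∈ Ioo x y, HasDerivAt g (g' s) s) (hn : ∀ s ∈ Ioo x y, 0 ≤ g' s) : g x ≤ g y := by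
  have : MonotoneOn g (Icc x y) := by
    apply monotoneOn_of_deriv_nonneg (convex_Icc x y) hc
    · intro z hz
      rw [interior_Icc] at hz
      exact (hd z hz).differentiableAt.differentiableWithinAt
    · intro z hz
      rw [interior_Icc] at hz
      rw [(hd z hz).deriv]
      exact hn z hz
  exact this ⟨le_rfl, hxy⟩ ⟨hxy, le_rfl⟩ hxy

section cmp
variable {k : ℕ} {f : ℝ → ℝ} {a M₁ M₂ β : ℝ} {r₁ v₁ r₂ v₂ : ℝ → ℝ}

lemma Br.qder {M : ℝ} {r v : ℝ → ℝ} (h : Br k f a M r v) {s : ℝ} (hs : s ∈ Ioo 0 M) :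
    HasDerivAt (fun s => r s ^ (2 * k + 2) * v s ^ 2) (-(2 * f s * r s ^ (2 * k + 2))) s := by
  have h1 := ((h.rder s hs).pow (2 * k + 2)).mul ((h.vder s hs).pow 2)
  refine HasDerivAt.congr_deriv h1 ?_
  have hv := (h.vpos s ⟨hs.1.le, hs.2⟩).ne'
  have hr := (h.apos.trans_le (h.rge s ⟨hs.1.le, hs.2.le⟩)).ne'
  simp only [Nat.add_succ_sub_one, Pi.pow_apply, Pi.mul_apply, Function.comp_apply]
  push_cast

  field_simp
  ring

lemma Br.Gder {M : ℝ} {r v : ℝ → ℝ} (hf : ContinuousOn f (Ici 0)) (h : Br k f a M r v) {s : ℝ}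
    (hs : s ∈ Ioo 0 M) :
    HasDerivAt (fun s => r s ^ (2 * k + 2) * v s ^ 2 + 2 * Fint f s * r s ^ (2 * k + 2))
      (4 * ((k : ℝ) + 1) * Fint f s * (r s ^ (2 * k + 1) * (v s)⁻¹)) s := by
  have h1 := (h.qder hs).add
    (((Fint_hasDeriv hf hs.1).const_mul 2).mul ((h.rder s hs).pow (2 * k + 2)))
  refine HasDerivAt.congr_deriv h1 ?_
  simp only [Nat.add_succ_sub_one, Pi.pow_apply, Pi.mul_apply, Function.comp_apply]
  push_cast

  ring

lemma Br.rle (h₁ : Br k f a M₁ r₁ v₁) (h₂ : Br k f a M₂ r₂ v₂) {t : ℝ} (ht0 : 0 ≤ t)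
    (ht1 : t ≤ M₁) (ht2 : t ≤ M₂) (hv : ∀ s ∈ Ico 0 t, v₁ s < v₂ s) : r₂ t ≤ r₁ t := by
  have := mono_aux (g := fun s => r₁ s - r₂ s) (g' := fun s => (v₁ s)⁻¹ - (v₂ s)⁻¹) ht0
    ((h₁.rcont.mono (Icc_subset_Icc_right ht1)).sub (h₂.rcont.mono (Icc_subset_Icc_right ht2)))
    (fun s hs => (h₁.rder s ⟨hs.1, hs.2.trans_le ht1⟩).sub (h₂.rder s ⟨hs.1, hs.2.trans_le ht2⟩))
    (fun s hs => by
      have := h₁.vpos s ⟨hs.1.le, hs.2.trans_le ht1⟩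
      have h3 := inv_anti₀ this (hv s ⟨hs.1.le, hs.2⟩).le
      linarith)
  simp only [h₁.r0, h₂.r0] at this
  linarith

lemma Br.Glt (hf : ContinuousOn f (Ici 0)) (hF : ∀ s ∈ Icc 0 β, Fint f s ≤ 0)
    (h₁ : Br k f a M₁ r₁ v₁) (h₂ : Br k f a M₂ r₂ v₂) (h0 : v₁ 0 < v₂ 0) {t : ℝ} (ht0 : 0 ≤ t)
    (ht1 : t ≤ M₁) (ht2 : t ≤ M₂) (hv : ∀ s ∈ Ico 0 t, v₁ s < v₂ s) (htβ : t ≤ β) :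
    r₁ t ^ (2 * k + 2) * v₁ t ^ 2 + 2 * Fint f t * r₁ t ^ (2 * k + 2) <
      r₂ t ^ (2 * k + 2) * v₂ t ^ 2 + 2 * Fint f t * r₂ t ^ (2 * k + 2) := by
  have hFc := Fint_cont hf t ht0
  have r1c := h₁.rcont.mono (Icc_subset_Icc_right ht1)
  have r2c := h₂.rcont.mono (Icc_subset_Icc_right ht2)
  have v1c := h₁.vcont.mono (Icc_subset_Icc_right ht1)
  have v2c := h₂.vcont.mono (Icc_subset_Icc_right ht2)
  have := mono_aux (x := 0) (y := t)
    (g := fun s => (r₂ s ^ (2 * k + 2) * v₂ s ^ 2 + 2 * Fint f s * r₂ s ^ (2 * k + 2)) -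
      (r₁ s ^ (2 * k + 2) * v₁ s ^ 2 + 2 * Fint f s * r₁ s ^ (2 * k + 2)))
    (g' := fun s => 4 * ((k : ℝ) + 1) * Fint f s * (r₂ s ^ (2 * k + 1) * (v₂ s)⁻¹) -
      4 * ((k : ℝ) + 1) * Fint f s * (r₁ s ^ (2 * k + 1) * (v₁ s)⁻¹)) ht0
    (by fun_prop)
    (fun s hs => (h₂.Gder hf ⟨hs.1, hs.2.trans_le ht2⟩).sub
      (h₁.Gder hf ⟨hs.1, hs.2.trans_le ht1⟩))
    (fun s hs => by
      have hv1 := h₁.vpos s ⟨hs.1.le, hs.2.trans_le ht1⟩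
      have hv2 := h₂.vpos s ⟨hs.1.le, hs.2.trans_le ht2⟩
      have h3 := inv_anti₀ hv1 (hv s ⟨hs.1.le, hs.2⟩).le
      have h4 : r₂ s ≤ r₁ s := h₁.rle h₂ hs.1.le (hs.2.le.trans ht1) (hs.2.le.trans ht2)
        (fun x hx => hv x ⟨hx.1, hx.2.trans hs.2⟩)
      have hr2 : 0 < r₂ s := h₁.apos.trans_le (h₂.rge s ⟨hs.1.le, hs.2.le.trans ht2⟩)
      have hr1 : 0 < r₁ s := hr2.trans_le h4
      have h5 : r₂ s ^ (2 * k + 1) * (v₂ s)⁻¹ ≤ r₁ s ^ (2 * k + 1) * (v₁ s)⁻¹ := by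
        gcongr
      have h6 : 4 * ((k : ℝ) + 1) * Fint f s ≤ 0 :=
        mul_nonpos_of_nonneg_of_nonpos (by positivity) (hF s ⟨hs.1.le, hs.2.le.trans htβ⟩)
      have := mul_le_mul_of_nonpos_left h5 h6
      linarith)
  have hF0 : Fint f 0 = 0 := by simp [Fint]
  simp only [h₁.r0, h₂.r0, hF0] at this
  have h1p := h₁.vpos 0 ⟨le_rfl, h₁.Mpos⟩
  have h7 : v₁ 0 ^ 2 < v₂ 0 ^ 2 := by gcongr
  have h8 : a ^ (2 * k + 2) * v₁ 0 ^ 2 < a ^ (2 * k + 2) * v₂ 0 ^ 2 :=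
    mul_lt_mul_of_pos_left h7 (pow_pos h₁.apos _)
  linarith

lemma Br.qlt (hf : ContinuousOn f (Ici 0)) (hβ : 0 ≤ β) (hF : ∀ s ∈ Icc 0 β, Fint f s ≤ 0)
    (hFβ : Fint f β = 0) (hfpos : ∀ s, β < s → 0 < f s)
    (h₁ : Br k f a M₁ r₁ v₁) (h₂ : Br k f a M₂ r₂ v₂) (h0 : v₁ 0 < v₂ 0) {t : ℝ}
    (ht1 : t ≤ M₁) (ht2 : t ≤ M₂) (hv : ∀ s ∈ Ico 0 t, v₁ s < v₂ s) (htβ : β ≤ t) :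
    r₁ t ^ (2 * k + 2) * v₁ t ^ 2 < r₂ t ^ (2 * k + 2) * v₂ t ^ 2 := by
  have hG := Br.Glt hf hF h₁ h₂ h0 hβ (htβ.trans ht1) (htβ.trans ht2)
    (fun x hx => hv x ⟨hx.1, hx.2.trans_le htβ⟩) le_rfl
  rw [hFβ] at hG
  have r1c := h₁.rcont.mono (Icc_subset_Icc hβ ht1)
  have r2c := h₂.rcont.mono (Icc_subset_Icc hβ ht2)
  have v1c := h₁.vcont.mono (Icc_subset_Icc hβ ht1)
  have v2c := h₂.vcont.mono (Icc_subset_Icc hβ ht2)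
  have := mono_aux (x := β) (y := t)
    (g := fun s => r₂ s ^ (2 * k + 2) * v₂ s ^ 2 - r₁ s ^ (2 * k + 2) * v₁ s ^ 2)
    (g' := fun s => -(2 * f s * r₂ s ^ (2 * k + 2)) - -(2 * f s * r₁ s ^ (2 * k + 2))) htβ
    (by fun_prop)
    (fun s hs => (h₂.qder ⟨hβ.trans_lt hs.1, hs.2.trans_le ht2⟩).sub
      (h₁.qder ⟨hβ.trans_lt hs.1, hs.2.trans_le ht1⟩))
    (fun s hs => by
      have hs0 : 0 < s := hβ.trans_lt hs.1
      have h4 : r₂ s ≤ r₁ s := h₁.rle h₂ hs0.le (hs.2.le.trans ht1) (hs.2.le.trans ht2)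
        (fun x hx => hv x ⟨hx.1, hx.2.trans hs.2⟩)
      have hr2 : 0 < r₂ s := h₁.apos.trans_le (h₂.rge s ⟨hs0.le, hs.2.le.trans ht2⟩)
      have h5 : r₂ s ^ (2 * k + 2) ≤ r₁ s ^ (2 * k + 2) := by gcongr
      have := mul_le_mul_of_nonneg_left h5 (hfpos s hs.1).le
      linarith)

  linarith

lemma Br.vlt (hf : ContinuousOn f (Ici 0)) (hβ : 0 ≤ β) (hF : ∀ s ∈ Icc 0 β, Fint f s ≤ 0)
    (hFβ : Fint f β = 0) (hfpos : ∀ s, β < s → 0 < f s)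
    (h₁ : Br k f a M₁ r₁ v₁) (h₂ : Br k f a M₂ r₂ v₂) (h0 : v₁ 0 < v₂ 0) :
    ∀ s ∈ Icc 0 (min M₁ M₂), v₁ s < v₂ s := by
  by_contra! hcon
  set S := {s ∈ Icc 0 (min M₁ M₂) | v₂ s ≤ v₁ s} with hS
  have v1c := h₁.vcont.mono (Icc_subset_Icc_right (min_le_left M₁ M₂))
  have v2c := h₂.vcont.mono (Icc_subset_Icc_right (min_le_right M₁ M₂))
  have hScl : IsClosed S := isClosed_Icc.isClosed_le v2c v1c
  have hne : S.Nonempty := by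
    obtain ⟨s, hs, h⟩ := hcon
    exact ⟨s, hs, h⟩
  have hbd : BddBelow S := ⟨0, fun s hs => hs.1.1⟩
  have ht := hScl.csInf_mem hne hbd
  set t := sInf S
  have hv : ∀ s ∈ Ico 0 t, v₁ s < v₂ s := by
    intro s hs
    by_contra hc
    have : s ∈ S := ⟨⟨hs.1, hs.2.le.trans ht.1.2⟩, not_lt.1 hc⟩
    exact absurd (csInf_le hbd this) (not_le.2 hs.2)
  have ht0 := ht.1.1
  have ht1 := ht.1.2.trans (min_le_left _ _)
  have ht2 := ht.1.2.trans (min_le_right _ _)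
  have hvt := ht.2
  have hr := h₁.rle h₂ ht0 ht1 ht2 hv
  have hr2 : 0 < r₂ t := h₁.apos.trans_le (h₂.rge t ⟨ht0, ht2⟩)
  have h5 : r₂ t ^ (2 * k + 2) ≤ r₁ t ^ (2 * k + 2) := by gcongr
  have hp : 0 < r₂ t ^ (2 * k + 2) := by positivity
  have hv2 : 0 ≤ v₂ t := by
    rcases eq_or_lt_of_le ht2 with h | h
    · rw [h, h₂.vM]
    · exact (h₂.vpos t ⟨ht0, h⟩).le
  have hsq : v₂ t ^ 2 ≤ v₁ t ^ 2 := by gcongr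
  rcases le_total t β with h | h
  · have hG := Br.Glt hf hF h₁ h₂ h0 ht0 ht1 ht2 hv h
    have hE := h₂.En t ⟨ht0, ht2⟩
    have h6 : r₂ t ^ (2 * k + 2) * (v₂ t ^ 2 + 2 * Fint f t) ≤
      r₁ t ^ (2 * k + 2) * (v₁ t ^ 2 + 2 * Fint f t) := by
      apply mul_le_mul h5 (by linarith) hE (by linarith)
    linarith
  · have hq := Br.qlt hf hβ hF hFβ hfpos h₁ h₂ h0 ht1 ht2 hv h
    have h6 : r₂ t ^ (2 * k + 2) * v₂ t ^ 2 ≤ r₁ t ^ (2 * k + 2) * v₁ t ^ 2 := by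
      apply mul_le_mul h5 hsq (by positivity) (by linarith)
    linarith

lemma Br.Pder {M : ℝ} {r v : ℝ → ℝ} (hf : ContinuousOn f (Ici 0)) (h : Br k f a M r v) {s d : ℝ}
    (hs : s ∈ Ioo 0 M) (hfs : 0 < f s) (hd : HasDerivAt (fun t => Fint f t / f t) d s) :
    HasDerivAt (fun s => -2 * ((k : ℝ) + 2) * (Fint f s / f s) * r s ^ (k + 1) * v s
      - r s ^ (k + 2) * v s ^ 2 - 2 * r s ^ (k + 2) * Fint f s)
      (((k : ℝ) - 2 * ((k : ℝ) + 2) * d) * (r s ^ (k + 1) * v s)) s := by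
  have hr' := h.rder s hs
  have hv' := h.vder s hs
  have h1 := ((((hd.const_mul (-2 * ((k : ℝ) + 2))).mul (hr'.pow (k + 1))).mul hv').sub
    ((hr'.pow (k + 2)).mul (hv'.pow 2))).sub
    (((hr'.pow (k + 2)).const_mul 2).mul (Fint_hasDeriv hf hs.1))
  refine HasDerivAt.congr_deriv h1 ?_
  have hv := (h.vpos s ⟨hs.1.le, hs.2⟩).ne'
  have hr := (h.apos.trans_le (h.rge s ⟨hs.1.le, hs.2.le⟩)).ne'
  simp only [Nat.add_succ_sub_one, Pi.pow_apply, Pi.mul_apply, Function.comp_apply]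
  push_cast
  field_simp
  ring

end cmp

lemma step_main (k : ℕ) (f : ℝ → ℝ) (β a M₁ M₂ : ℝ) (r₁ v₁ r₂ v₂ : ℝ → ℝ)
    (hf : ContinuousOn f (Ici 0)) (hβ : 0 ≤ β) (hF : ∀ s ∈ Icc 0 β, Fint f s ≤ 0)
    (hFβ : Fint f β = 0) (hfpos : ∀ s, β < s → 0 < f s)
    (hf3 : CondF3 (k + 2) f β)
    (h₁ : Br k f a M₁ r₁ v₁) (h₂ : Br k f a M₂ r₂ v₂) (h0 : v₁ 0 < v₂ 0) :
    -2 * ((k : ℝ) + 2) * (Fint f M₁ / f M₁) * r₂ M₁ ^ (k + 1) * v₂ M₁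
      - r₂ M₁ ^ (k + 2) * v₂ M₁ ^ 2 - 2 * r₂ M₁ ^ (k + 2) * Fint f M₁ <
    -2 * ((k : ℝ) + 2) * (Fint f M₁ / f M₁) * r₁ M₁ ^ (k + 1) * v₁ M₁
      - r₁ M₁ ^ (k + 2) * v₁ M₁ ^ 2 - 2 * r₁ M₁ ^ (k + 2) * Fint f M₁ := by
  have hv := Br.vlt hf hβ hF hFβ hfpos h₁ h₂ h0
  have hM : M₁ < M₂ := by
    by_contra hc
    rw [min_eq_right (not_lt.1 hc)] at hv
    have := hv M₂ ⟨h₂.Mpos.le, le_rfl⟩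
    rw [h₂.vM] at this
    rcases eq_or_lt_of_le (not_lt.1 hc) with h | h
    · rw [h, h₁.vM] at this
      exact lt_irrefl _ this
    · have := h₁.vpos M₂ ⟨h₂.Mpos.le, h⟩
      linarith
  rw [min_eq_left hM.le] at hv
  have hβM : β < M₁ := by
    by_contra hc
    have := hF M₁ ⟨h₁.Mpos.le, not_lt.1 hc⟩
    linarith [h₁.FM]
  have hr : ∀ t ∈ Icc 0 M₁, r₂ t ≤ r₁ t := fun t ht =>
    h₁.rle h₂ ht.1 ht.2 (ht.2.trans hM.le) (fun s hs => hv s ⟨hs.1, hs.2.le.trans ht.2⟩)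
  have hq : ∀ t ∈ Icc β M₁, r₁ t ^ (2 * k + 2) * v₁ t ^ 2 < r₂ t ^ (2 * k + 2) * v₂ t ^ 2 :=
    fun t ht => Br.qlt hf hβ hF hFβ hfpos h₁ h₂ h0 ht.2 (ht.2.trans hM.le)
      (fun s hs => hv s ⟨hs.1, hs.2.le.trans ht.2⟩) ht.1
  have hr2p : ∀ t ∈ Icc 0 M₁, 0 < r₂ t := fun t ht =>
    h₁.apos.trans_le (h₂.rge t ⟨ht.1, ht.2.trans hM.le⟩)
  have hv2p : ∀ t ∈ Icc 0 M₁, 0 < v₂ t := fun t ht => h₂.vpos t ⟨ht.1, ht.2.trans_lt hM⟩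
  -- the square roots
  have hw : ∀ t ∈ Icc β M₁, r₁ t ^ (k + 1) * v₁ t < r₂ t ^ (k + 1) * v₂ t := by
    intro t ht
    have ht' : t ∈ Icc 0 M₁ := ⟨hβ.trans ht.1, ht.2⟩
    have hp2 := hr2p t ht'
    have hp3 := hv2p t ht'
    apply lt_of_pow_lt_pow_left₀ 2 (by positivity)
    have := hq t ht
    calc _ = r₁ t ^ (2 * k + 2) * v₁ t ^ 2 := by ring
      _ < _ := this
      _ = _ := by ring
  have hFc : ContinuousOn (Fint f) (Icc 0 M₁) := Fint_cont hf M₁ h₁.Mpos.le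
  have r1c := h₁.rcont
  have r2c := h₂.rcont.mono (Icc_subset_Icc_right hM.le)
  have v1c := h₁.vcont
  have v2c := h₂.vcont.mono (Icc_subset_Icc_right hM.le)
  have hβ' : β ∈ Icc 0 M₁ := ⟨hβ, hβM.le⟩
  -- starting point
  obtain ⟨s₀, hs₀, hst⟩ : ∃ s₀ ∈ Ioo β M₁, 0 < r₂ s₀ ^ (k + 2) * (v₂ s₀ ^ 2 + 2 * Fint f s₀) -
      r₁ s₀ ^ (k + 2) * (v₁ s₀ ^ 2 + 2 * Fint f s₀) := by
    have hc : ContinuousOn (fun s => r₂ s ^ (k + 2) * (v₂ s ^ 2 + 2 * Fint f s) -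
      r₁ s ^ (k + 2) * (v₁ s ^ 2 + 2 * Fint f s)) (Icc 0 M₁) := by fun_prop
    have hpos : 0 < r₂ β ^ (k + 2) * (v₂ β ^ 2 + 2 * Fint f β) -
      r₁ β ^ (k + 2) * (v₁ β ^ 2 + 2 * Fint f β) := by
      rw [hFβ]
      have h4 := hq β ⟨le_rfl, hβM.le⟩
      have h5 := hr β hβ'
      have h6 := hr2p β hβ'
      have h7 : r₂ β ^ k ≤ r₁ β ^ k := by gcongr
      have h8 : 0 < r₂ β ^ k := by positivity
      have h9 : r₂ β ^ k * (r₁ β ^ (k + 2) * v₁ β ^ 2) < r₂ β ^ k * (r₂ β ^ (k + 2) * v₂ β ^ 2) := by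
        calc _ ≤ r₁ β ^ k * (r₁ β ^ (k + 2) * v₁ β ^ 2) := by
              apply mul_le_mul_of_nonneg_right h7
              have : 0 < r₁ β := h6.trans_le h5
              positivity
          _ = r₁ β ^ (2 * k + 2) * v₁ β ^ 2 := by ring
          _ < _ := h4
          _ = _ := by ring
      have := lt_of_mul_lt_mul_left h9 h8.le
      linarith
    have hev := (hc β hβ').eventually (lt_mem_nhds hpos)
    have hev2 := hev.filter_mono (nhdsWithin_mono β
      (show Ioo β M₁ ⊆ Icc 0 M₁ from fun x hx => ⟨hβ.trans hx.1.le, hx.2.le⟩))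
    haveI : (nhdsWithin β (Ioo β M₁)).NeBot := left_nhdsWithin_Ioo_neBot hβM
    obtain ⟨s, hs1, hs2⟩ := (hev2.and self_mem_nhdsWithin).exists
    exact ⟨s, hs2, hs1⟩
  have hs₀0 : 0 < s₀ := hβ.trans_lt hs₀.1
  choose! d hd1 hd2 using hf3
  have hHc : ContinuousOn (fun t => Fint f t / f t) (Icc s₀ M₁) := fun s hs =>
    (hd2 s (hs₀.1.trans_le hs.1)).continuousAt.continuousWithinAt
  have hsub : Icc s₀ M₁ ⊆ Icc 0 M₁ := Icc_subset_Icc_left hs₀0.le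
  replace r1c := r1c.mono hsub
  replace r2c := r2c.mono hsub
  replace v1c := v1c.mono hsub
  replace v2c := v2c.mono hsub
  replace hFc := hFc.mono hsub
  have key := mono_aux (x := s₀) (y := M₁) (g := fun s =>
      (-2 * ((k : ℝ) + 2) * (Fint f s / f s) * r₁ s ^ (k + 1) * v₁ s
      - r₁ s ^ (k + 2) * v₁ s ^ 2 - 2 * r₁ s ^ (k + 2) * Fint f s) -
      (-2 * ((k : ℝ) + 2) * (Fint f s / f s) * r₂ s ^ (k + 1) * v₂ s
      - r₂ s ^ (k + 2) * v₂ s ^ 2 - 2 * r₂ s ^ (k + 2) * Fint f s))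
    (g' := fun s => ((k : ℝ) - 2 * ((k : ℝ) + 2) * d s) * (r₁ s ^ (k + 1) * v₁ s) -
      ((k : ℝ) - 2 * ((k : ℝ) + 2) * d s) * (r₂ s ^ (k + 1) * v₂ s)) hs₀.2.le
    (by
      have e : ∀ (r v : ℝ → ℝ), ContinuousOn r (Icc s₀ M₁) → ContinuousOn v (Icc s₀ M₁) →
        ContinuousOn (fun s => -2 * ((k : ℝ) + 2) * (Fint f s / f s) * r s ^ (k + 1) * v s
          - r s ^ (k + 2) * v s ^ 2 - 2 * r s ^ (k + 2) * Fint f s) (Icc s₀ M₁) := by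
        intro r v hr hv
        exact ((((continuousOn_const.mul hHc).mul (hr.pow _)).mul hv).sub
          ((hr.pow _).mul (hv.pow _))).sub ((continuousOn_const.mul (hr.pow _)).mul hFc)
      exact (e r₁ v₁ r1c v1c).sub (e r₂ v₂ r2c v2c))
    (fun s hs => by
      have hsβ : β < s := hs₀.1.trans hs.1
      exact (h₁.Pder hf ⟨hs₀0.trans hs.1, hs.2⟩ (hfpos s hsβ) (hd2 s hsβ)).sub
        (h₂.Pder hf ⟨hs₀0.trans hs.1, hs.2.trans hM⟩ (hfpos s hsβ) (hd2 s hsβ)))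
    (fun s hs => by
      have hsβ : β < s := hs₀.1.trans hs.1
      have h4 := (hw s ⟨hsβ.le, hs.2.le⟩).le
      have h5 := hd1 s hsβ
      push_cast at h5
      have hk : (0:ℝ) < 2 * ((k : ℝ) + 2) := by positivity
      rw [div_le_iff₀ hk] at h5
      have h6 : (k : ℝ) - 2 * ((k : ℝ) + 2) * d s ≤ 0 := by linarith
      have := mul_le_mul_of_nonpos_left h4 h6
      linarith)

  -- sign of the first term at the starting point
  have hFs : 0 ≤ Fint f s₀ := by
    have := mono_aux (x := β) (y := s₀) (g := Fint f) (g' := f) hs₀.1.le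
      ((Fint_cont hf s₀ hs₀0.le).mono (Icc_subset_Icc_left hβ))
      (fun s hs => Fint_hasDeriv hf (hβ.trans_lt hs.1)) (fun s hs => (hfpos s hs.1).le)
    linarith
  have hH : 0 ≤ Fint f s₀ / f s₀ := div_nonneg hFs (hfpos s₀ hs₀.1).le
  have hw0 := hw s₀ ⟨hs₀.1.le, hs₀.2.le⟩
  have h8 : 0 ≤ 2 * ((k : ℝ) + 2) * (Fint f s₀ / f s₀) *
      (r₂ s₀ ^ (k + 1) * v₂ s₀ - r₁ s₀ ^ (k + 1) * v₁ s₀) :=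
    mul_nonneg (by positivity) (by linarith)
  nlinarith [key, h8, hst]

/-- Step three (Proposition 3.4): under (f1)–(f3), `P₁(M₁) > P₂(M₁)`. -/
theorem step_three
    (n : ℕ) (hn : 2 ≤ n) (f : ℝ → ℝ) (β B : ℝ)
    (hf1 : CondF1 f) (hf2 : CondF2 f β B) (hf3 : CondF3 n f β)
    (a b : ℝ) (ha : 0 < a) (hab : a < b)
    (u₁ u₁' u₂ u₂' : ℝ → ℝ)
    (h₁ : IsPosSolAnn n a b f u₁ u₁') (h₂ : IsPosSolAnn n a b f u₂ u₂')
    (hslope₁ : 0 < u₁' a) (hslope₁₂ : u₁' a < u₂' a)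
    (c₁ c₂ : ℝ) (hc₁ : c₁ ∈ Ioo a b) (hc₂ : c₂ ∈ Ioo a b)
    (hc₁up : ∀ r ∈ Ico a c₁, 0 < u₁' r) (hc₁down : ∀ r ∈ Ioo c₁ b, u₁' r < 0)
    (hc₂up : ∀ r ∈ Ico a c₂, 0 < u₂' r) (hc₂down : ∀ r ∈ Ioo c₂ b, u₂' r < 0)
    (M₁ M₂ : ℝ) (hM₁ : M₁ = u₁ c₁) (hM₂ : M₂ = u₂ c₂)
    (r₁ r₂ : ℝ → ℝ)
    (hr₁mem : ∀ s ∈ Icc (0:ℝ) M₁, r₁ s ∈ Icc a c₁ ∧ u₁ (r₁ s) = s)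
    (hr₁inv : ∀ r ∈ Icc a c₁, r₁ (u₁ r) = r)
    (hr₂mem : ∀ s ∈ Icc (0:ℝ) M₂, r₂ s ∈ Icc a c₂ ∧ u₂ (r₂ s) = s)
    (hr₂inv : ∀ r ∈ Icc a c₂, r₂ (u₂ r) = r)
    :
    Pfun n f r₂ u₂' M₁ < Pfun n f r₁ u₁' M₁ := by
  obtain ⟨k, rfl⟩ : ∃ k, n = k + 2 := ⟨n - 2, by omega⟩
  have hf := hf1.1
  have hfacts : 0 ≤ β ∧ (∀ s ∈ Icc 0 β, Fint f s ≤ 0) ∧ Fint f β = 0 ∧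
      (∀ s, β < s → 0 < f s) := by
    have hF0 : Fint f 0 = 0 := by simp [Fint]
    rcases hf2 with ⟨rfl, -, -, h⟩ | ⟨-, hB, hBβ, hp, hneg, -, hFβ⟩
    · refine ⟨le_rfl, ?_, hF0, h⟩
      intro s hs
      rw [le_antisymm hs.2 hs.1, hF0]
    · refine ⟨(hB.trans hBβ).le, ?_, hFβ, fun s hs => hp s (hBβ.trans hs)⟩
      intro s hs
      rcases le_total s B with h | h
      · have := mono_aux (x := 0) (y := s) (g := fun t => -Fint f t) (g' := fun t => -f t) hs.1
          (Fint_cont hf s hs.1).neg (fun t ht => (Fint_hasDeriv hf ht.1).neg)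
          (fun t ht => by
            have := hneg t ⟨ht.1.le, ht.2.le.trans h⟩
            linarith)
        simp only [hF0] at this
        linarith
      · have := mono_aux (x := s) (y := β) (g := Fint f) (g' := f) hs.2
          ((Fint_cont hf β (hB.trans hBβ).le).mono (Icc_subset_Icc_left hs.1))
          (fun t ht => Fint_hasDeriv hf (hs.1.trans_lt ht.1))
          (fun t ht => (hp t (h.trans_lt ht.1)).le)
        linarith
  obtain ⟨hβ, hF, hFβ, hfpos⟩ := hfacts
  have b1 := mk_br k f hf a b ha hab u₁ u₁' h₁ c₁ hc₁ hc₁up hc₁down M₁ hM₁ r₁ hr₁mem hr₁inv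
  have b2 := mk_br k f hf a b ha hab u₂ u₂' h₂ c₂ hc₂ hc₂up hc₂down M₂ hM₂ r₂ hr₂mem hr₂inv
  have h0 : (fun s => u₁' (r₁ s)) 0 < (fun s => u₂' (r₂ s)) 0 := by
    simp only [b1.r0, b2.r0]
    exact hslope₁₂
  have := step_main k f β a M₁ M₂ r₁ _ r₂ _ hf hβ hF hFβ hfpos hf3 b1 b2 h0
  unfold Pfun
  push_cast
  exact this
end
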